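/- Let 1 ≤ p, q ≤ ∞ and h ∈ H^{p,q}(S). Then h admits tempered traces h_0 along ℝ and h_1 along ℝ + i; these traces are functions h_0 ∈ L^p(ℝ) and h_1 ∈ L^q(ℝ) satisfying ‖h_0‖_{L^p(ℝ)} + ‖h_1‖_{L^q(ℝ)} ≤ 2 ‖h‖_{H^{p,q}} and ĥ_1(k) = e^{−k} ĥ_0(k) in the sense of tempered distributions. -/

import Mathlib

open MeasureTheory Complex Filter Set
open scoped Real ENNReal Topology

noncomputable section

def Strip : Set ℂ := {z : ℂ | 0 < z.im ∧ z.im < 1}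

def bLine (h : ℂ → ℂ) (y : ℝ) : ℝ → ℂ := fun x => h (x + y * Complex.I)

def hardyNorm (p q : ℝ≥0∞) (h : ℂ → ℂ) : ℝ≥0∞ :=
  ⨆ y ∈ Set.Ioo (0:ℝ) 1,
    ⨅ (f : ℝ → ℂ) (g : ℝ → ℂ) (_ : Measurable f) (_ : Measurable g)
      (_ : f + g = bLine h y),
      ENNReal.ofReal (1 - y)⁻¹ * eLpNorm f p volume +
        ENNReal.ofReal y⁻¹ * eLpNorm g q volume

def MemHardy (p q : ℝ≥0∞) (h : ℂ → ℂ) : Prop :=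
  DifferentiableOn ℂ h Strip ∧ hardyNorm p q h < ⊤

def IsTrace0 (h : ℂ → ℂ) (v : ℝ → ℂ) : Prop :=
  ∀ φ : SchwartzMap ℝ ℂ,
    Tendsto (fun y : ℝ => ∫ x : ℝ, h (x + y * Complex.I) * (starRingEnd ℂ) (φ x))
      (𝓝[>] (0:ℝ)) (𝓝 (∫ x : ℝ, v x * (starRingEnd ℂ) (φ x)))

def IsTrace1 (h : ℂ → ℂ) (w : ℝ → ℂ) : Prop :=
  ∀ φ : SchwartzMap ℝ ℂ,
    Tendsto (fun y : ℝ => ∫ x : ℝ, h (x + y * Complex.I) * (starRingEnd ℂ) (φ x))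
      (𝓝[<] (1:ℝ)) (𝓝 (∫ x : ℝ, w x * (starRingEnd ℂ) (φ x)))

/-- Fourier transform with the convention `f̂(k) = ∫ f(x) e^{-ikx} dx`. -/
def fInt (φ : ℝ → ℂ) (x : ℝ) : ℂ := ∫ k : ℝ, φ k * Complex.exp (-(Complex.I * k * x))

/-- `ĥ₁ = e^{-·} ĥ₀` in the sense of tempered distributions, tested against
Fourier transforms of compactly supported smooth functions. -/
def FourierRelExp (h0 h1 : ℝ → ℂ) : Prop :=
  ∀ φ : ℝ → ℂ, ContDiff ℝ (⊤ : ℕ∞) φ → HasCompactSupport φ →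
    (∫ x : ℝ, h1 x * fInt φ x) = ∫ x : ℝ, h0 x * fInt (fun k => Real.exp (-k) * φ k) x

lemma strip_cauchy {F : ℂ → ℂ} {a b : ℝ} (hab : a ≤ b) {C : ℝ≥0∞} (hC : C ≠ ⊤)
    (hF : DifferentiableOn ℂ F {z | a ≤ z.im ∧ z.im ≤ b})
    (hI : ∀ y ∈ Icc a b, ∫⁻ x : ℝ, ‖F (x + y * I)‖ₑ ≤ C) :
    ∫ x : ℝ, F (x + a * I) = ∫ x : ℝ, F (x + b * I) := by
  have hcl : ∀ y ∈ Icc a b, Continuous fun x : ℝ => F (x + y * I) := by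
    intro y hy
    refine hF.continuousOn.comp_continuous (by fun_prop) (fun x => ?_)
    simpa using hy
  have hint : ∀ y ∈ Icc a b, Integrable fun x : ℝ => F (x + y * I) := by
    intro y hy
    exact ⟨(hcl y hy).aestronglyMeasurable, lt_of_le_of_lt (hI y hy) hC.lt_top⟩
  let cl : ℝ → ℝ := fun y => max a (min y b)
  have hclm : ∀ y, cl y ∈ Icc a b := fun y => ⟨le_max_left _ _, max_le hab (min_le_right _ _)⟩
  have hcle : ∀ y ∈ Icc a b, cl y = y := by
    intro y hy
    simp [cl, hy.1, hy.2]
  let G : ℝ → ℝ → ℂ := fun x y => F (x + cl y * I)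
  have hG : Continuous (fun p : ℝ × ℝ => G p.1 p.2) := by
    refine hF.continuousOn.comp_continuous ?_ (fun p => ?_)
    · have : Continuous cl := by fun_prop
      fun_prop
    · simpa using hclm p.2
  let U : ℝ → ℝ≥0∞ := fun x => ∫⁻ y in Ioc a b, ‖G x y‖ₑ
  have hGm : Measurable (fun p : ℝ × ℝ => ‖G p.1 p.2‖ₑ) := hG.measurable.enorm
  have hUm : Measurable U := hGm.lintegral_prod_right'
  have hU : ∫⁻ x, U x < ⊤ := by
    have : ∫⁻ x, U x = ∫⁻ y in Ioc a b, ∫⁻ x, ‖G x y‖ₑ :=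
      lintegral_lintegral_swap hGm.aemeasurable
    rw [this]
    calc _ ≤ ∫⁻ y in Ioc a b, C := lintegral_mono (fun y => hI _ (hclm y))
      _ < ⊤ := by
        simp only [lintegral_const, MeasurableSet.univ, Measure.restrict_apply, univ_inter]
        exact ENNReal.mul_lt_top hC.lt_top (by simp)
  by_contra hne
  set D := (∫ x : ℝ, F (x + a * I)) - ∫ x : ℝ, F (x + b * I) with hD
  have hD0 : 0 < ‖D‖ := norm_pos_iff.2 (sub_ne_zero.2 hne)
  have key : ∀ R : ℝ, ‖(∫ x in (-R)..R, F (x + a * I)) - ∫ x in (-R)..R, F (x + b * I)‖ₑ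
      ≤ U R + U (-R) := by
    intro R
    have hr := integral_boundary_rect_eq_zero_of_differentiableOn F (-R + a * I) (R + b * I)
      (hF.mono (by
        intro z hz
        have := hz.2
        simpa [uIcc_of_le hab] using this))
    have hside : ∀ r : ℝ, ‖I • ∫ y in a..b, F (r + y * I)‖ₑ ≤ U r := by
      intro r
      rw [enorm_smul, intervalIntegral.integral_of_le hab]
      have : ‖I‖ₑ = 1 := by simp [enorm_eq_nnnorm]
      rw [this, one_mul]
      refine (enorm_integral_le_lintegral_enorm _).trans (le_of_eq ?_)
      refine setLIntegral_congr_fun measurableSet_Ioc (fun y hy => ?_)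
      simp only [G, hcle y (Ioc_subset_Icc_self hy)]
    simp at hr
    have e : (∫ x in (-R)..R, F (x + a * I)) - ∫ x in (-R)..R, F (x + b * I)
      = I • (∫ y in a..b, F ((-R : ℝ) + y * I)) - I • (∫ y in a..b, F (R + y * I)) := by
      simp only [smul_eq_mul, ofReal_neg]
      linear_combination hr
    rw [e]
    refine (enorm_sub_le).trans ?_
    rw [add_comm]
    exact add_le_add (hside R) (hside (-R))
  have hlim : Tendsto (fun R : ℝ => (∫ x in (-R)..R, F (x + a * I)) - ∫ x in (-R)..R, F (x + b * I))
      atTop (𝓝 D) := by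
    refine Tendsto.sub ?_ ?_
    · exact intervalIntegral_tendsto_integral (hint a ⟨le_rfl, hab⟩) tendsto_neg_atTop_atBot tendsto_id
    · exact intervalIntegral_tendsto_integral (hint b ⟨hab, le_rfl⟩) tendsto_neg_atTop_atBot tendsto_id
  have hev : ∀ᶠ R in atTop, ENNReal.ofReal (‖D‖ / 2) ≤ U R + U (-R) := by
    have h1 := hlim.norm.eventually (lt_mem_nhds (half_lt_self hD0))
    filter_upwards [h1] with R hR
    refine le_trans ?_ (key R)
    rw [← ofReal_norm]
    exact ENNReal.ofReal_le_ofReal hR.le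
  obtain ⟨R0, hR0⟩ := eventually_atTop.1 hev
  have h2 : ∫⁻ R, (U R + U (-R)) < ⊤ := by
    rw [lintegral_add_left hUm, lintegral_neg_eq_self]
    exact ENNReal.add_lt_top.2 ⟨hU, hU⟩
  have h3 : ∫⁻ R in Ici R0, ENNReal.ofReal (‖D‖ / 2) ≤ ∫⁻ R, (U R + U (-R)) :=
    (setLIntegral_mono (hUm.add (hUm.comp measurable_neg)) (fun R hR => hR0 R hR)).trans
      (setLIntegral_le_lintegral _ _)
  have h4 : ∫⁻ R in Ici R0, ENNReal.ofReal (‖D‖ / 2) = ⊤ := by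
    simp [ENNReal.mul_eq_top, hD0]
  rw [h4] at h3
  exact absurd h2 (not_lt.2 h3)

/-- Standing hypothesis: holomorphic on the strip with a uniform weighted `L¹` bound. -/
structure WB (W : ℝ → ℝ) (C : ℝ≥0∞) (h : ℂ → ℂ) : Prop where
  diff : DifferentiableOn ℂ h Strip
  meas : Measurable W
  fin : C ≠ ⊤
  bd : ∀ y ∈ Ioo (0:ℝ) 1, ∫⁻ x : ℝ, ‖h (x + y * I)‖ₑ * ENNReal.ofReal (W x) ≤ C

lemma WB.cont {W C h} (hh : WB W C h) {y : ℝ} (hy : y ∈ Ioo (0:ℝ) 1) :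
    Continuous fun x : ℝ => h (x + y * I) := by
  refine hh.diff.continuousOn.comp_continuous (by fun_prop) (fun x => ?_)
  simpa [Strip] using hy

lemma WB.lint {W C h} (hh : WB W C h) {y : ℝ} (hy : y ∈ Ioo (0:ℝ) 1) {g : ℝ → ℂ} {B : ℝ}
    (hB : 0 ≤ B) (hg : ∀ x, ‖g x‖ ≤ B * W x) :
    ∫⁻ x : ℝ, ‖h (x + y * I) * g x‖ₑ ≤ ENNReal.ofReal B * C := by
  calc _ ≤ ∫⁻ x : ℝ, ENNReal.ofReal B * (‖h (x + y * I)‖ₑ * ENNReal.ofReal (W x)) := by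
        refine lintegral_mono (fun x => ?_)
        rw [enorm_mul, mul_left_comm, ← ENNReal.ofReal_mul hB]
        gcongr
        rw [← ofReal_norm]
        exact ENNReal.ofReal_le_ofReal (hg x)
    _ ≤ _ := by
        rw [lintegral_const_mul' _ _ ENNReal.ofReal_ne_top]
        gcongr
        exact hh.bd y hy

lemma WB.integrable {W C h} (hh : WB W C h) {y : ℝ} (hy : y ∈ Ioo (0:ℝ) 1) {g : ℝ → ℂ} {B : ℝ}
    (hB : 0 ≤ B) (hg : ∀ x, ‖g x‖ ≤ B * W x) (hgm : AEStronglyMeasurable g) :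
    Integrable fun x : ℝ => h (x + y * I) * g x := by
  refine ⟨(hh.cont hy).aestronglyMeasurable.mul hgm, lt_of_le_of_lt (hh.lint hy hB hg) ?_⟩
  exact ENNReal.mul_lt_top ENNReal.ofReal_lt_top hh.fin.lt_top

lemma WB.shift {W C h} (hh : WB W C h) {ψ : ℂ → ℂ} {a b c : ℝ} (ha : 0 < a) (hab : a ≤ b)
    (hb : b < 1) {B : ℝ} (hB : 0 ≤ B)
    (hψ : DifferentiableOn ℂ ψ {z | c ≤ z.im ∧ z.im ≤ c + (b - a)})
    (hψB : ∀ z : ℂ, c ≤ z.im → z.im ≤ c + (b - a) → ‖ψ z‖ ≤ B * W z.re) :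
    ∫ x : ℝ, h (x + a * I) * ψ (x + c * I) =
      ∫ x : ℝ, h (x + b * I) * ψ (x + (c + (b - a) : ℝ) * I) := by
  have := strip_cauchy (F := fun z => h z * ψ (z + (c - a : ℝ) * I)) hab
    (C := ENNReal.ofReal B * C) (ENNReal.mul_ne_top ENNReal.ofReal_ne_top hh.fin) ?_ ?_
  · convert! this using 4 <;> · congr 1; push_cast; ring
  · refine DifferentiableOn.mul (hh.diff.mono ?_) ?_
    · rintro z ⟨h1, h2⟩
      exact ⟨by linarith, by linarith⟩
    · refine hψ.comp (by fun_prop) ?_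
      rintro z ⟨h1, h2⟩
      constructor <;> simp <;> linarith
  · intro y hy
    refine hh.lint (y := y) ⟨by linarith [hy.1], by linarith [hy.2]⟩ hB
      (g := fun x => ψ (x + y * I + (c - a : ℝ) * I)) (fun x => ?_)
    have := hψB (x + y * I + (c - a : ℝ) * I) (by simp; linarith [hy.1]) (by simp; linarith [hy.2])
    simpa using this

lemma WB.limit0 {W C h} (hh : WB W C h) {ψ : ℂ → ℂ} {B : ℝ} (hB : 0 ≤ B) {c : ℝ}
    (hψ : DifferentiableOn ℂ ψ {z | c ≤ z.im ∧ z.im ≤ c + 1})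
    (hψB : ∀ z : ℂ, c ≤ z.im → z.im ≤ c + 1 → ‖ψ z‖ ≤ B * W z.re) :
    Tendsto (fun y : ℝ => ∫ x : ℝ, h (x + y * I) * ψ (x + c * I)) (𝓝[>] (0:ℝ))
      (𝓝 (∫ x : ℝ, h (x + (1/2:ℝ) * I) * ψ (x + (c + 1/2 : ℝ) * I))) := by
  have hhalf : (1/2:ℝ) ∈ Ioo (0:ℝ) 1 := by norm_num
  have hmem : Ioo (0:ℝ) (1/2) ∈ 𝓝[>] (0:ℝ) := Ioo_mem_nhdsGT (by norm_num)
  have e : ∀ᶠ y in 𝓝[>] (0:ℝ), ∫ x : ℝ, h (x + (1/2:ℝ) * I) * ψ (x + (c + (1/2 - y) : ℝ) * I)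
      = ∫ x : ℝ, h (x + y * I) * ψ (x + c * I) := by
    filter_upwards [hmem] with y hy
    refine (hh.shift hy.1 hy.2.le hhalf.2 hB (hψ.mono ?_) ?_).symm
    · rintro z ⟨h1, h2⟩
      exact ⟨h1, by linarith [hy.1]⟩
    · intro z h1 h2
      exact hψB z h1 (by linarith [hy.1])
  refine Tendsto.congr' e ?_
  have hmain : ∀ y ∈ Ioo (0:ℝ) (1/2), ∀ x : ℝ, ((x:ℂ) + (c + (1/2 - y) : ℝ) * I) ∈
      {z : ℂ | c ≤ z.im ∧ z.im ≤ c + 1} := by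
    intro y hy x
    constructor <;> simp <;> linarith [hy.1, hy.2]
  have hWB : ∀ x : ℝ, 0 ≤ B * W x := fun x => (norm_nonneg _).trans
      (by simpa using hψB (x + c * I) (by simp) (by simp))
  refine tendsto_integral_filter_of_dominated_convergence
    (fun x => ‖h (x + (1/2:ℝ) * I)‖ * (B * W x)) ?_ ?_ ?_ ?_
  · filter_upwards [hmem] with y hy
    refine (hh.cont hhalf).aestronglyMeasurable.mul ?_
    exact (hψ.continuousOn.comp_continuous (by fun_prop) (hmain y hy)).aestronglyMeasurable
  · filter_upwards [hmem] with y hy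
    refine Eventually.of_forall (fun x => ?_)
    rw [norm_mul]
    gcongr
    simpa using hψB _ (hmain y hy x).1 (hmain y hy x).2
  · have hm : AEStronglyMeasurable (fun x : ℝ => B * W x) := by
      exact (hh.meas.const_mul B).aestronglyMeasurable
    have := (hh.integrable hhalf hB (g := fun x => ((B * W x : ℝ) : ℂ)) (fun x => by
      rw [norm_real, Real.norm_of_nonneg (hWB x)])
      (Complex.continuous_ofReal.comp_aestronglyMeasurable hm)).norm
    refine this.congr (Eventually.of_forall fun x => ?_)
    simp only [norm_mul, norm_real, Real.norm_of_nonneg (hWB x)]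
  · refine Eventually.of_forall (fun x => ?_)
    refine Tendsto.const_mul _ ?_
    have hc : ContinuousWithinAt ψ {z : ℂ | c ≤ z.im ∧ z.im ≤ c + 1} (x + (c + 1/2 : ℝ) * I) :=
      hψ.continuousOn _ (by constructor <;> simp <;> linarith)
    refine hc.tendsto.comp (tendsto_nhdsWithin_iff.2 ⟨?_, ?_⟩)
    · have : Continuous fun y : ℝ => (x:ℂ) + (c + (1/2 - y) : ℝ) * I := by fun_prop
      have := (this.tendsto 0).mono_left (nhdsWithin_le_nhds (s := Ioi 0))
      simpa using this
    · filter_upwards [hmem] with y hy using hmain y hy x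

/-- finite grid adapted to a compact null set -/
lemma exists_grid {K : Set ℝ} (hK : IsCompact K) (hK0 : volume K = 0) {ε : ℝ} (hε : 0 < ε) :
    ∃ δ : ℝ, 0 < δ ∧ δ ≤ ε ∧ ∃ J : Finset ℤ, (J.card : ℝ) * δ ≤ ε ∧
      (∀ x ∈ K, ∃ j ∈ J, |x - j * δ| ≤ δ) ∧ (∀ j ∈ J, ∃ x ∈ K, |x - j * δ| ≤ δ) := by
  have h1 := tendsto_measure_cthickening_of_isCompact (μ := volume) hK
  rw [hK0] at h1
  have h2 : ∀ᶠ r in 𝓝[>] (0:ℝ), volume (Metric.cthickening r K) < ENNReal.ofReal ε :=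
    (h1.mono_left nhdsWithin_le_nhds).eventually (gt_mem_nhds (by simpa using hε))
  obtain ⟨δ, hδ, hδm⟩ := (h2.and (Ioo_mem_nhdsGT hε)).exists
  have hδ0 : 0 < δ := hδm.1
  have hloc : ∀ x : ℝ, (⌊x / δ⌋ : ℝ) * δ ≤ x ∧ x < (⌊x / δ⌋ + 1 : ℝ) * δ := by
    intro x
    have a := Int.floor_le (x / δ)
    have b := Int.lt_floor_add_one (x / δ)
    exact ⟨(le_div_iff₀ hδ0).1 a, (div_lt_iff₀ hδ0).1 b⟩
  have hfin : ((fun x : ℝ => ⌊x / δ⌋) '' K).Finite := by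
    obtain ⟨M, hM⟩ := hK.isBounded.exists_norm_le
    refine (Set.finite_Icc (⌊-M / δ⌋) (⌊M / δ⌋)).subset ?_
    rintro _ ⟨x, hx, rfl⟩
    have := abs_le.1 (hM x hx)
    constructor <;> · apply Int.floor_le_floor; gcongr; linarith
  refine ⟨δ, hδ0, hδm.2.le, hfin.toFinset, ?_, ?_, ?_⟩
  · have hd : Pairwise (Function.onFun Disjoint fun j : ℤ => Ico ((j:ℝ) * δ) ((j + 1 : ℝ) * δ)) := by
      intro i j hij
      rw [Function.onFun, Set.disjoint_left]
      rintro x ⟨a1, a2⟩ ⟨b1, b2⟩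
      apply hij
      have ei : ⌊x / δ⌋ = i := Int.floor_eq_iff.2 ⟨(le_div_iff₀ hδ0).2 a1, (div_lt_iff₀ hδ0).2 a2⟩
      have ej : ⌊x / δ⌋ = j := Int.floor_eq_iff.2 ⟨(le_div_iff₀ hδ0).2 b1, (div_lt_iff₀ hδ0).2 b2⟩
      rw [← ei, ← ej]
    have hm := measure_biUnion_finset (μ := volume) (s := hfin.toFinset)
      (f := fun j : ℤ => Ico ((j:ℝ) * δ) ((j + 1 : ℝ) * δ)) (fun i _ j _ hij => hd hij)
      (fun _ _ => measurableSet_Ico)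
    have hsub : (⋃ j ∈ hfin.toFinset, Ico ((j:ℝ) * δ) ((j + 1 : ℝ) * δ)) ⊆
        Metric.cthickening δ K := by
      intro t ht
      simp only [mem_iUnion] at ht
      obtain ⟨j, hj, ht⟩ := ht
      obtain ⟨x, hx, rfl⟩ := (hfin.mem_toFinset).1 hj
      refine Metric.mem_cthickening_of_dist_le t x δ K hx ?_
      rw [Real.dist_eq, abs_le]
      have := hloc x
      constructor <;> nlinarith [ht.1, ht.2]
    have hle := (measure_mono (μ := volume) hsub).trans hδ.le
    rw [hm] at hle
    simp only [Real.volume_Ico] at hle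
    have : ∀ j : ℤ, ((j + 1 : ℝ) * δ - j * δ) = δ := fun j => by ring
    simp only [this, Finset.sum_const, nsmul_eq_mul] at hle
    rw [← ENNReal.ofReal_natCast, ← ENNReal.ofReal_mul (by positivity)] at hle
    exact (ENNReal.ofReal_le_ofReal_iff hε.le).1 hle
  · intro x hx
    refine ⟨⌊x / δ⌋, hfin.mem_toFinset.2 ⟨x, hx, rfl⟩, ?_⟩
    have := hloc x
    rw [abs_le]; constructor <;> nlinarith
  · intro j hj
    obtain ⟨x, hx, rfl⟩ := (hfin.mem_toFinset).1 hj
    refine ⟨x, hx, ?_⟩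
    have := hloc x
    rw [abs_le]; constructor <;> nlinarith

lemma exists_peak {K : Set ℝ} (hK : IsCompact K) (hK0 : volume K = 0) :
    ∃ g : ℕ → ℂ → ℂ, (∀ n, DifferentiableOn ℂ (g n) {z | 0 ≤ z.im}) ∧
      (∀ n z, 0 ≤ z.im → ‖g n z‖ ≤ 1) ∧
      (∀ x ∈ K, Tendsto (fun n => g n (x : ℂ)) atTop (𝓝 0)) ∧
      (∀ z : ℂ, 0 ≤ z.im → z ∉ ((↑) : ℝ → ℂ) '' K → Tendsto (fun n => g n z) atTop (𝓝 1)) := by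
  have hε : ∀ n : ℕ, (0:ℝ) < 1 / ((n:ℝ) + 1) ^ 2 := fun n => by positivity
  choose δ hδ hδε J hJc hJ1 hJ2 using fun n => exists_grid hK hK0 (hε n)
  let P : ℕ → ℂ → ℂ := fun n z => ∑ j ∈ J n, (n:ℂ) * (δ n * I / (z + δ n * I - j * δ n))
  have hden : ∀ n (z : ℂ), 0 ≤ z.im → ∀ j : ℤ, z + δ n * I - j * δ n ≠ 0 := by
    intro n z hz j h0
    have := congrArg Complex.im h0
    simp at this
    linarith [hδ n]
  have hre : ∀ (n : ℕ) (z : ℂ) (j : ℤ), ((n:ℂ) * (δ n * I / (z + δ n * I - j * δ n))).re =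
      n * (δ n * (z.im + δ n) / ((z.re - j * δ n) ^ 2 + (z.im + δ n) ^ 2)) := by
    intro n z j
    rw [← ofReal_natCast, re_ofReal_mul, Complex.div_re]
    simp [Complex.normSq_apply]
    left
    ring_nf
  have hre0 : ∀ (n : ℕ) (z : ℂ) (j : ℤ), 0 ≤ z.im → 0 ≤ ((n:ℂ) * (δ n * I / (z + δ n * I - j * δ n))).re := by
    intro n z j hz
    rw [hre]
    have := hδ n
    positivity
  refine ⟨fun n z => cexp (-P n z), ?_, ?_, ?_, ?_⟩
  · intro n
    refine DifferentiableOn.cexp (DifferentiableOn.neg ?_)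
    refine DifferentiableOn.fun_sum (fun j _ => ?_)
    refine DifferentiableOn.const_mul (DifferentiableOn.div (by fun_prop) (by fun_prop) ?_) _
    intro z hz
    exact hden n z hz j
  · intro n z hz
    rw [Complex.norm_exp]
    simp only [neg_re, P, re_sum]
    rw [Real.exp_le_one_iff]
    have := Finset.sum_nonneg (fun j (_ : j ∈ J n) => hre0 n z j hz)
    linarith
  · intro x hx
    rw [tendsto_zero_iff_norm_tendsto_zero]
    have hlim : Tendsto (fun n : ℕ => Real.exp (-((n:ℝ) / 2))) atTop (𝓝 0) := by
      refine Real.tendsto_exp_neg_atTop_nhds_zero.comp ?_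
      exact tendsto_natCast_atTop_atTop.atTop_div_const (by norm_num)
    refine squeeze_zero (fun _ => norm_nonneg _) (fun n => ?_) hlim
    rw [Complex.norm_exp]
    simp only [neg_re, P, re_sum]
    rw [Real.exp_le_exp]
    obtain ⟨j, hj, hxj⟩ := hJ1 n x hx
    have h1 := Finset.single_le_sum (fun j (_ : j ∈ J n) => hre0 n (x:ℂ) j (by simp)) hj
    have h2 : (n:ℝ) / 2 ≤ ((n:ℂ) * (δ n * I / ((x:ℂ) + δ n * I - j * δ n))).re := by
      rw [hre]
      simp only [ofReal_re, ofReal_im, zero_add]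
      rw [div_eq_mul_one_div]
      have hd := hδ n
      refine mul_le_mul_of_nonneg_left ?_ (Nat.cast_nonneg n)
      rw [div_le_div_iff₀ (by norm_num) (by positivity)]
      have := sq_le_sq' (by linarith [abs_le.1 hxj]) (abs_le.1 hxj).2
      nlinarith
    linarith
  · intro z hz hzK
    have hKc : IsClosed (((↑) : ℝ → ℂ) '' K) := (hK.image continuous_ofReal).isClosed
    have : ∃ d > 0, ∀ x ∈ K, d ≤ ‖z - (x:ℂ)‖ := by
      have := hKc.isOpen_compl.mem_nhds hzK
      obtain ⟨d, hd, hd2⟩ := Metric.mem_nhds_iff.1 this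
      refine ⟨d, hd, fun x hx => ?_⟩
      by_contra hlt
      push Not at hlt
      refine hd2 (a := (x:ℂ)) ?_ ⟨x, hx, rfl⟩
      rw [Metric.mem_ball, dist_comm, dist_eq_norm]
      exact hlt
    obtain ⟨d, hd, hdK⟩ := this
    have hlim0 : Tendsto (fun n : ℕ => 1 / ((n:ℝ) + 1)) atTop (𝓝 0) :=
      tendsto_one_div_add_atTop_nhds_zero_nat
    have hP : Tendsto (fun n => P n z) atTop (𝓝 0) := by
      rw [tendsto_zero_iff_norm_tendsto_zero]
      have hlim : Tendsto (fun n : ℕ => (2 / d) * (1 / ((n:ℝ) + 1))) atTop (𝓝 0) := by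
        simpa using hlim0.const_mul (2 / d)
      refine squeeze_zero' (Eventually.of_forall fun _ => norm_nonneg _) ?_ hlim
      filter_upwards [hlim0.eventually (gt_mem_nhds (show (0:ℝ) < d / 4 by positivity))] with n hn
      have hδn : δ n ≤ d / 4 := by
        refine (hδε n).trans (le_trans ?_ hn.le)
        rw [div_le_div_iff₀ (by positivity) (by positivity)]
        nlinarith [(Nat.cast_nonneg n : (0:ℝ) ≤ n)]
      have hd0 := hδ n
      have hterm : ∀ j ∈ J n, ‖(n:ℂ) * (δ n * I / (z + δ n * I - j * δ n))‖ ≤ n * (δ n * (2 / d)) := by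
        intro j hj
        obtain ⟨x, hx, hxj⟩ := hJ2 n j hj
        have h1 := hdK x hx
        have h2 : d / 2 ≤ ‖z + δ n * I - j * δ n‖ := by
          have e : z - (x:ℂ) = (z + δ n * I - j * δ n) - (δ n * I + ((x - j * δ n : ℝ) : ℂ)) := by
            push_cast; ring
          have t1 := norm_sub_le (z + δ n * I - j * δ n) (δ n * I + ((x - j * δ n : ℝ) : ℂ))
          have t2 := norm_add_le ((δ n : ℂ) * I) ((x - j * δ n : ℝ) : ℂ)
          rw [← e] at t1
          rw [norm_mul, norm_I, norm_real, norm_real, Real.norm_of_nonneg hd0.le, Real.norm_eq_abs] at t2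
          linarith
        rw [norm_mul, norm_div, norm_mul, norm_I, norm_real, Real.norm_of_nonneg hd0.le, mul_one,
          Complex.norm_natCast, div_eq_mul_one_div]
        refine mul_le_mul_of_nonneg_left (mul_le_mul_of_nonneg_left ?_ hd0.le) (Nat.cast_nonneg n)
        rw [div_le_div_iff₀ (by linarith) hd]
        linarith
      refine (norm_sum_le_of_le _ hterm).trans ?_
      rw [Finset.sum_const, nsmul_eq_mul]
      have hc := hJc n
      calc (J n).card * (n * (δ n * (2 / d))) = (2 / d) * (n * ((J n).card * δ n)) := by ring
        _ ≤ (2 / d) * (n * (1 / ((n:ℝ) + 1) ^ 2)) := by gcongr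
        _ ≤ _ := by
          gcongr
          rw [mul_one_div, div_le_div_iff₀ (by positivity) (by positivity)]
          nlinarith [(Nat.cast_nonneg n : (0:ℝ) ≤ n)]
    have := (Complex.continuous_exp.tendsto _).comp hP.neg
    rw [neg_zero, Complex.exp_zero] at this
    exact this

lemma exists_limit_measure (k : ℝ → ℝ → ℝ) (hk : ∀ y ∈ Ioo (0:ℝ) 1, Continuous (k y))
    (hk0 : ∀ y x, 0 ≤ k y x) {C : ℝ≥0∞} (hC : C ≠ ⊤)
    (hb : ∀ y ∈ Ioo (0:ℝ) 1, ∫⁻ x, ENNReal.ofReal (k y x) * ENNReal.ofReal (1 + x ^ 2) ≤ C)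
    (U : Ultrafilter ℝ) (hU : (U : Filter ℝ) ≤ 𝓝[>] 0) :
    ∃ ν : Measure ℝ, IsFiniteMeasure ν ∧ ∀ f : ℝ → ℂ, Continuous f → (∃ B, ∀ x, ‖f x‖ ≤ B) →
      Tendsto (fun y => ∫ x, (k y x : ℂ) * f x) U (𝓝 (∫ x, f x ∂ν)) := by
  classical
  let c : NNReal := C.toNNReal
  have hc : (c : ℝ≥0∞) = C := ENNReal.coe_toNNReal hC
  let μ : ℝ → Measure ℝ := fun y => volume.withDensity (fun x => ENNReal.ofReal (k y x))
  have htail : ∀ y ∈ Ioo (0:ℝ) 1, ∀ n : ℕ, μ y (Icc (-(n:ℝ)) n)ᶜ ≤ C * ENNReal.ofReal (1 / (1 + (n:ℝ) ^ 2)) := by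
    intro y hy n
    rw [withDensity_apply _ measurableSet_Icc.compl, mul_comm]
    refine le_trans ?_ (mul_le_mul_right (hb y hy) _)
    rw [← lintegral_const_mul' _ _ ENNReal.ofReal_ne_top, ← lintegral_indicator measurableSet_Icc.compl]
    refine lintegral_mono (fun x => ?_)
    by_cases hx : x ∈ (Icc (-(n:ℝ)) n)ᶜ
    swap
    · rw [indicator_of_notMem hx]; exact zero_le
    rw [indicator_of_mem hx]
    rw [mul_left_comm, ← ENNReal.ofReal_mul (by positivity)]
    refine le_mul_of_one_le_right (by positivity) ?_
    rw [ENNReal.one_le_ofReal, one_div, inv_mul_eq_div, one_le_div (by positivity)]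
    have : (n:ℝ) ≤ |x| := by
      by_contra h
      push Not at h
      exact hx ⟨(abs_lt.1 h).1.le, (abs_lt.1 h).2.le⟩
    have := pow_le_pow_left₀ (by positivity) this 2
    rw [sq_abs] at this
    linarith
  have hmass : ∀ y ∈ Ioo (0:ℝ) 1, μ y univ ≤ C := by
    intro y hy
    rw [withDensity_apply _ MeasurableSet.univ, Measure.restrict_univ]
    refine le_trans (lintegral_mono fun x => ?_) (hb y hy)
    refine le_mul_of_one_le_right (by positivity) ?_
    rw [ENNReal.one_le_ofReal]
    nlinarith [sq_nonneg x]
  have hfinm : ∀ y ∈ Ioo (0:ℝ) 1, IsFiniteMeasure (μ y) := fun y hy =>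
    ⟨(hmass y hy).trans_lt hC.lt_top⟩
  let M : ℝ → FiniteMeasure ℝ := fun y => if hy : y ∈ Ioo (0:ℝ) 1 then ⟨μ y, hfinm y hy⟩ else 0
  let u : ℕ → NNReal := fun n => c * Real.toNNReal (1 / (1 + (n:ℝ) ^ 2))
  have hu : Tendsto u atTop (𝓝 0) := by
    have h1 : Tendsto (fun n : ℕ => 1 / (1 + (n:ℝ) ^ 2)) atTop (𝓝 0) := by
      refine squeeze_zero (fun n => by positivity) (fun n => ?_)
        tendsto_one_div_add_atTop_nhds_zero_nat
      rw [div_le_div_iff₀ (by positivity) (by positivity)]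
      have : (n:ℝ) ≤ (n:ℝ) ^ 2 := by exact_mod_cast Nat.le_self_pow (by norm_num) n
      linarith
    have := (((continuous_real_toNNReal.tendsto _).comp h1)).const_mul c
    simpa [u, Function.comp_def] using this
  have hcomp := isCompact_setOfPred_finiteMeasure_mass_le_compl_isCompact_le (E := ℝ) (u := u)
    (K := fun n : ℕ => Icc (-(n:ℝ)) n) c hu (fun n => isCompact_Icc) (Or.inl inferInstance)
  have hmemU : Ioo (0:ℝ) 1 ∈ (U : Filter ℝ) := hU (Ioo_mem_nhdsGT (by norm_num))
  have hle : ((U.map M : Ultrafilter (FiniteMeasure ℝ)) : Filter (FiniteMeasure ℝ)) ≤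
      𝓟 {μ : FiniteMeasure ℝ | μ.mass ≤ c ∧ ∀ n : ℕ, μ (Icc (-(n:ℝ)) n)ᶜ ≤ u n} := by
    rw [le_principal_iff, Ultrafilter.mem_coe, Ultrafilter.mem_map]
    filter_upwards [hmemU] with y hy
    have hM : M y = ⟨μ y, hfinm y hy⟩ := dif_pos hy
    have hM' : (M y : Measure ℝ) = μ y := by rw [hM]; rfl
    refine ⟨?_, fun n => ?_⟩
    · rw [← ENNReal.coe_le_coe, FiniteMeasure.ennreal_mass, hc, hM']
      exact hmass y hy
    · rw [← ENNReal.coe_le_coe, FiniteMeasure.ennreal_coeFn_eq_coeFn_toMeasure, ENNReal.coe_mul, hc, hM']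
      exact htail y hy n
  obtain ⟨ν, -, hν⟩ := hcomp.ultrafilter_le_nhds _ hle
  refine ⟨ν, inferInstance, fun f hf hfB => ?_⟩
  obtain ⟨B, hB⟩ := hfB
  have ht : Tendsto M U (𝓝 ν) := hν
  rw [FiniteMeasure.tendsto_iff_forall_integral_rclike_tendsto ℂ] at ht
  have := ht (BoundedContinuousFunction.ofNormedAddCommGroup f hf B hB)
  refine Tendsto.congr' ?_ this
  filter_upwards [hmemU] with y hy
  have hM : M y = ⟨μ y, hfinm y hy⟩ := dif_pos hy
  rw [hM]
  change ∫ x, f x ∂(μ y) = _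
  rw [integral_withDensity_eq_integral_toReal_smul (hk y hy).measurable.ennreal_ofReal (by simp)]
  refine integral_congr_ae (Eventually.of_forall fun x => ?_)
  simp [ENNReal.toReal_ofReal (hk0 y x)]

lemma density_diff (ν1 ν2 : Measure ℝ) [IsFiniteMeasure ν1] [IsFiniteMeasure ν2]
    (h : ∀ K : Set ℝ, IsCompact K → volume K = 0 → ν1 K = ν2 K) :
    ∃ ρ : ℝ → ℝ, Integrable ρ ∧ ∀ f : ℝ → ℂ, Continuous f → (∃ B, ∀ x, ‖f x‖ ≤ B) →
      ∫ x, f x ∂ν1 - ∫ x, f x ∂ν2 = ∫ x, (ρ x : ℂ) * f x := by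
  have hnull : ∀ A : Set ℝ, MeasurableSet A → volume A = 0 → ν1 A = ν2 A := by
    intro A hA hA0
    rw [hA.measure_eq_iSup_isCompact, hA.measure_eq_iSup_isCompact]
    refine iSup_congr fun K => iSup_congr fun hK => iSup_congr fun hKc => ?_
    exact h K hKc (measure_mono_null hK hA0)
  obtain ⟨S1, hS1, h1, h1'⟩ := Measure.mutuallySingular_singularPart ν1 volume
  obtain ⟨S2, hS2, h2, h2'⟩ := Measure.mutuallySingular_singularPart ν2 volume
  let N := S1ᶜ ∪ S2ᶜ
  have hN : MeasurableSet N := hS1.compl.union hS2.compl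
  have hN0 : volume N = 0 := measure_union_null h1' h2'
  have key : ∀ (ν : Measure ℝ) [IsFiniteMeasure ν], ν.singularPart volume Nᶜ = 0 →
      ∀ A, MeasurableSet A → ν.singularPart volume A = ν (A ∩ N) := by
    intro ν _ hν A hA
    conv_rhs => rw [← Measure.singularPart_add_rnDeriv ν volume]
    rw [Measure.add_apply, withDensity_absolutelyContinuous _ _ (measure_mono_null inter_subset_right hN0),
      add_zero]
    rw [← measure_inter_add_sdiff A hN, sdiff_eq, measure_mono_null inter_subset_right hν, add_zero]
  have hs : ν1.singularPart volume = ν2.singularPart volume := by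
    ext A hA
    rw [key ν1 (measure_mono_null (by simp [N]) h1) A hA,
      key ν2 (measure_mono_null (by simp [N]) h2) A hA]
    exact hnull _ (hA.inter hN) (measure_mono_null inter_subset_right hN0)
  have dec : ∀ (ν : Measure ℝ) [IsFiniteMeasure ν] (f : ℝ → ℂ), Continuous f → (∃ B, ∀ x, ‖f x‖ ≤ B) →
      ∫ x, f x ∂ν = ∫ x, f x ∂(ν.singularPart volume) + ∫ x, ((ν.rnDeriv volume x).toReal : ℂ) * f x := by
    rintro ν _ f hf ⟨B, hB⟩
    have hi : ∀ (μ : Measure ℝ) [IsFiniteMeasure μ], Integrable f μ := fun μ _ =>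
      Integrable.of_bound hf.aestronglyMeasurable B (Eventually.of_forall hB)
    conv_lhs => rw [← Measure.singularPart_add_rnDeriv ν volume]
    rw [integral_add_measure (hi _) (hi _),
      integral_withDensity_eq_integral_toReal_smul (Measure.measurable_rnDeriv _ _)
        (Measure.rnDeriv_lt_top _ _)]
    simp
  have hint : ∀ (ν : Measure ℝ) [IsFiniteMeasure ν], Integrable (fun x => (ν.rnDeriv volume x).toReal) :=
    fun ν _ => Measure.integrable_toReal_rnDeriv
  refine ⟨fun x => (ν1.rnDeriv volume x).toReal - (ν2.rnDeriv volume x).toReal, (hint ν1).sub (hint ν2), ?_⟩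
  intro f hf hfB
  rw [dec ν1 f hf hfB, dec ν2 f hf hfB, hs, add_sub_add_left_eq_sub]
  obtain ⟨B, hB⟩ := hfB
  have hi2 : ∀ (ν : Measure ℝ) [IsFiniteMeasure ν], Integrable (fun x => ((ν.rnDeriv volume x).toReal : ℂ) * f x) :=
    fun ν _ => ((hint ν).ofReal (𝕜 := ℂ)).mul_bdd (c := B) hf.aestronglyMeasurable (Eventually.of_forall hB)
  rw [← integral_sub (hi2 ν1) (hi2 ν2)]
  simp [sub_mul]

lemma restrict_eq (ν1 ν2 ν3 ν4 : Measure ℝ) [IsFiniteMeasure ν1] [IsFiniteMeasure ν2]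
    [IsFiniteMeasure ν3] [IsFiniteMeasure ν4]
    (h : ∀ t : ℝ, (∫ x : ℝ, cexp (t * x * I) ∂ν1 - ∫ x : ℝ, cexp (t * x * I) ∂ν2) +
      I * (∫ x : ℝ, cexp (t * x * I) ∂ν3 - ∫ x : ℝ, cexp (t * x * I) ∂ν4) = 0) :
    ν1 = ν2 ∧ ν3 = ν4 := by
  simp only [← charFun_apply_real] at h
  have h' : ∀ t : ℝ, (charFun ν1 t - charFun ν2 t) - I * (charFun ν3 t - charFun ν4 t) = 0 := by
    intro t
    have := congrArg (starRingEnd ℂ) (h (-t))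
    simpa [charFun_neg, sub_eq_add_neg, -neg_sub] using this
  constructor
  · refine Measure.ext_of_charFun (funext fun t => ?_)
    linear_combination (h t + h' t) / 2
  · refine Measure.ext_of_charFun (funext fun t => ?_)
    have := (h t).trans (h' t).symm
    have h2 : I * (charFun ν3 t - charFun ν4 t) = 0 := by linear_combination this / 2
    rcases mul_eq_zero.1 h2 with h3 | h3
    · exact absurd h3 I_ne_zero
    · exact sub_eq_zero.1 h3

lemma fm_riesz {C : ℝ≥0∞} {H : ℂ → ℂ} (hH : WB (fun x => 1 + x ^ 2) C H)
    (U : Ultrafilter ℝ) (hU : (U : Filter ℝ) ≤ 𝓝[>] 0) :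
    ∃ H0 : ℝ → ℂ, Integrable H0 ∧ ∀ f : ℝ → ℂ, Continuous f → (∃ B, ∀ x, ‖f x‖ ≤ B) →
      Tendsto (fun y : ℝ => ∫ x : ℝ, H (x + y * I) * f x) U (𝓝 (∫ x, H0 x * f x)) := by
  have hmemU : Ioo (0:ℝ) 1 ∈ (U : Filter ℝ) := hU (Ioo_mem_nhdsGT (by norm_num))
  have hb : ∀ (s : ℂ → ℝ), (∀ z, s z ≤ ‖z‖) → ∀ y ∈ Ioo (0:ℝ) 1,
      ∫⁻ x : ℝ, ENNReal.ofReal (max (s (H (x + y * I))) 0) * ENNReal.ofReal (1 + x ^ 2) ≤ C := by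
    intro s hs y hy
    refine (lintegral_mono fun x => ?_).trans (hH.bd y hy)
    gcongr
    rw [← ofReal_norm]
    exact ENNReal.ofReal_le_ofReal (max_le (hs _) (norm_nonneg _))
  have hex : ∀ (s : ℂ → ℝ), Continuous s → (∀ z, s z ≤ ‖z‖) → ∃ ν : Measure ℝ, IsFiniteMeasure ν ∧
      ∀ f : ℝ → ℂ, Continuous f → (∃ B, ∀ x, ‖f x‖ ≤ B) →
      Tendsto (fun y : ℝ => ∫ x : ℝ, ((max (s (H (x + y * I))) 0 : ℝ) : ℂ) * f x) U (𝓝 (∫ x, f x ∂ν)) := by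
    intro s hsc hs
    exact exists_limit_measure (fun y x => max (s (H (x + y * I))) 0)
      (fun y hy => (hsc.comp (hH.cont hy)).max continuous_const)
      (fun y x => le_max_right _ _) hH.fin (hb s hs) U hU
  obtain ⟨ν1, i1, h1⟩ := hex (fun z => z.re) continuous_re re_le_norm
  obtain ⟨ν2, i2, h2⟩ := hex (fun z => -z.re) continuous_re.neg
    (fun z => (neg_le_abs _).trans (abs_re_le_norm z))
  obtain ⟨ν3, i3, h3⟩ := hex (fun z => z.im) continuous_im (fun z => (le_abs_self _).trans (abs_im_le_norm z))
  obtain ⟨ν4, i4, h4⟩ := hex (fun z => -z.im) continuous_im.neg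
    (fun z => (neg_le_abs _).trans (abs_im_le_norm z))
  have hM : ∀ f : ℝ → ℂ, Continuous f → (∃ B, ∀ x, ‖f x‖ ≤ B) →
      Tendsto (fun y : ℝ => ∫ x : ℝ, H (x + y * I) * f x) U
        (𝓝 ((∫ x, f x ∂ν1 - ∫ x, f x ∂ν2) + I * (∫ x, f x ∂ν3 - ∫ x, f x ∂ν4))) := by
    intro f hf hfB
    refine Tendsto.congr' ?_ (((h1 f hf hfB).sub (h2 f hf hfB)).add
      (((h3 f hf hfB).sub (h4 f hf hfB)).const_mul I))
    filter_upwards [hmemU] with y hy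
    obtain ⟨B, hB⟩ := hfB
    have hint : ∀ (s : ℂ → ℝ), Continuous s → (∀ z, s z ≤ ‖z‖) →
        Integrable (fun x : ℝ => ((max (s (H (x + y * I))) 0 : ℝ) : ℂ) * f x) := by
      intro s hsc hs
      refine Integrable.mul_bdd (c := B) ?_ hf.aestronglyMeasurable (Eventually.of_forall hB)
      refine Integrable.ofReal ⟨((hsc.comp (hH.cont hy)).max continuous_const).aestronglyMeasurable, ?_⟩
      refine lt_of_le_of_lt (lintegral_mono fun x => ?_) ((hb s hs y hy).trans_lt hH.fin.lt_top)
      change ‖max (s (H (x + y * I))) 0‖ₑ ≤ _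
      rw [Real.enorm_of_nonneg (le_max_right _ _)]
      refine le_mul_of_one_le_right (by positivity) ?_
      rw [ENNReal.one_le_ofReal]
      nlinarith [sq_nonneg x]
    rw [← integral_sub, ← integral_sub, ← integral_const_mul, ← integral_add]
    · refine integral_congr_ae (Eventually.of_forall fun x => ?_)
      have hmax : ∀ a : ℝ, max a 0 - max (-a) 0 = a := fun a => by
        rcases le_total 0 a with h | h
        · rw [max_eq_left h, max_eq_right (by linarith)]; ring
        · rw [max_eq_right h, max_eq_left (by linarith)]; ring
      have e1 : ((max (H (x + y * I)).re 0 : ℝ) : ℂ) - ((max (-(H (x + y * I)).re) 0 : ℝ) : ℂ) =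
        ((H (x + y * I)).re : ℂ) := by rw [← ofReal_sub, hmax]
      have e2 : ((max (H (x + y * I)).im 0 : ℝ) : ℂ) - ((max (-(H (x + y * I)).im) 0 : ℝ) : ℂ) =
        ((H (x + y * I)).im : ℂ) := by rw [← ofReal_sub, hmax]
      have e3 := re_add_im (H (x + y * I))
      simp only
      linear_combination f x * e1 + I * f x * e2 + f x * e3
    all_goals first
      | exact hint _ continuous_re re_le_norm
      | exact hint _ continuous_re.neg (fun z => (neg_le_abs _).trans (abs_re_le_norm z))
      | exact hint _ continuous_im (fun z => (le_abs_self _).trans (abs_im_le_norm z))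
      | exact hint _ continuous_im.neg (fun z => (neg_le_abs _).trans (abs_im_le_norm z))
      | exact (hint _ continuous_re re_le_norm).sub
          (hint _ continuous_re.neg (fun z => (neg_le_abs _).trans (abs_re_le_norm z)))
      | exact ((hint _ continuous_im (fun z => (le_abs_self _).trans (abs_im_le_norm z))).sub
          (hint _ continuous_im.neg (fun z => (neg_le_abs _).trans (abs_im_le_norm z)))).const_mul I
  have hK : ∀ K : Set ℝ, IsCompact K → volume K = 0 →
      ν1.restrict K = ν2.restrict K ∧ ν3.restrict K = ν4.restrict K := by
    intro K hKc hK0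
    obtain ⟨g, gd, gb, g0, g1⟩ := exists_peak hKc hK0
    refine restrict_eq _ _ _ _ (fun t => ?_)
    -- the limit functional applied to a function analytic in the strip
    have hval : ∀ G : ℂ → ℂ, DifferentiableOn ℂ G {z | 0 ≤ z.im} → (∀ z, 0 ≤ z.im → ‖G z‖ ≤ 1) →
        (∫ x : ℝ, G x * cexp (t * x * I) ∂ν1 - ∫ x : ℝ, G x * cexp (t * x * I) ∂ν2) +
        I * (∫ x : ℝ, G x * cexp (t * x * I) ∂ν3 - ∫ x : ℝ, G x * cexp (t * x * I) ∂ν4) =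
        ∫ x : ℝ, H (x + (1 / 2 : ℝ) * I) * (G (x + (1 / 2 : ℝ) * I) * cexp (t * (x + (1 / 2 : ℝ) * I) * I)) := by
      intro G hG hGB
      have hb1 : ∀ z : ℂ, 0 ≤ z.im → z.im ≤ 1 → ‖G z * cexp (t * z * I)‖ ≤ Real.exp |t| := by
        intro z h0 h1
        rw [norm_mul, norm_exp]
        refine (mul_le_mul (hGB z h0) (Real.exp_le_exp.2 (?_ : _ ≤ |t|)) (by positivity) zero_le_one).trans (by rw [one_mul])
        simp
        nlinarith [neg_abs_le t, abs_nonneg t]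
      have hcont : Continuous (fun x : ℝ => G x * cexp (t * x * I)) := by
        have : Continuous (fun x : ℝ => G x) :=
          hG.continuousOn.comp_continuous continuous_ofReal (fun x => by simp)
        exact this.mul (by fun_prop)
      have hT := hM (fun x : ℝ => G x * cexp (t * x * I)) hcont
        ⟨Real.exp |t|, fun x => hb1 x (by simp) (by simp)⟩
      have hT2 := (hH.limit0 (c := 0) (B := Real.exp |t|) (ψ := fun z => G z * cexp (t * z * I))
        (by positivity) ?_ ?_).mono_left hU
      · simp only [ofReal_zero, zero_mul, add_zero, zero_add] at hT2
        exact tendsto_nhds_unique hT hT2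
      · refine DifferentiableOn.mul (hG.mono fun z hz => hz.1) ?_
        fun_prop
      · intro z h0 h1
        refine (hb1 z h0 (by linarith)).trans (le_mul_of_one_le_right (by positivity) ?_)
        nlinarith [sq_nonneg z.re]
    have hlim := fun (ν : Measure ℝ) (_ : IsFiniteMeasure ν) =>
      tendsto_integral_of_dominated_convergence (μ := ν) (F := fun n (x:ℝ) => g n x * cexp (t * x * I))
        (f := fun x : ℝ => Kᶜ.indicator (fun x : ℝ => cexp (t * x * I)) x) (fun _ => 1)
        (fun n => by
          have : Continuous (fun x : ℝ => g n x) :=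
            (gd n).continuousOn.comp_continuous continuous_ofReal (fun x => by simp)
          have : Continuous (fun x : ℝ => g n x * cexp (t * x * I)) := this.mul (by fun_prop)
          exact this.aestronglyMeasurable)
        (integrable_const _)
        (fun n => Eventually.of_forall fun x => by
          rw [norm_mul, ← ofReal_mul, norm_exp_ofReal_mul_I, mul_one]
          exact gb n x (by simp))
        (Eventually.of_forall fun x => by
          by_cases hx : x ∈ K
          · rw [indicator_of_notMem (by simpa using hx)]
            simpa using (g0 x hx).mul_const (cexp (t * x * I))
          · rw [indicator_of_mem (by simpa using hx)]
            simpa using (g1 x (by simp) (by simpa using hx)).mul_const (cexp (t * x * I)))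
    have hsplit : ∀ (ν : Measure ℝ) (_ : IsFiniteMeasure ν),
        ∫ x : ℝ, cexp (t * x * I) ∂(ν.restrict K) = ∫ x : ℝ, (1 : ℂ) * cexp (t * x * I) ∂ν -
          ∫ x, Kᶜ.indicator (fun x : ℝ => cexp (t * x * I)) x ∂ν := by
      intro ν _
      have hi : Integrable (fun x : ℝ => cexp (t * x * I)) ν := by
        refine Integrable.of_bound (Continuous.aestronglyMeasurable (by fun_prop)) 1 (Eventually.of_forall fun x => ?_)
        rw [← ofReal_mul, norm_exp_ofReal_mul_I]
      simp only [one_mul]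
      rw [integral_indicator hKc.measurableSet.compl, ← integral_add_compl hKc.measurableSet hi]
      ring
    have hr : Tendsto (fun n => ∫ x : ℝ, H (x + (1 / 2 : ℝ) * I) * (g n (x + (1 / 2 : ℝ) * I) * cexp (t * (x + (1 / 2 : ℝ) * I) * I)))
        atTop (𝓝 (∫ x : ℝ, H (x + (1 / 2 : ℝ) * I) * (1 * cexp (t * (x + (1 / 2 : ℝ) * I) * I)))) := by
      have hline : ∀ G : ℂ → ℂ, DifferentiableOn ℂ G {z | 0 ≤ z.im} →
          Continuous (fun x : ℝ => G (x + (1 / 2 : ℝ) * I) * cexp (t * (x + (1 / 2 : ℝ) * I) * I)) := by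
        intro G hG
        have : Continuous (fun x : ℝ => G (x + (1 / 2 : ℝ) * I)) :=
          hG.continuousOn.comp_continuous (by fun_prop) (fun x => by simp)
        exact this.mul (by fun_prop)
      refine tendsto_integral_of_dominated_convergence
        (fun x : ℝ => ‖H (x + (1 / 2 : ℝ) * I) * (1 * cexp (t * (x + (1 / 2 : ℝ) * I) * I))‖) ?_ ?_ ?_ ?_
      · intro n
        exact ((hH.cont (y := 1 / 2) (by norm_num)).mul (hline _ (gd n))).aestronglyMeasurable
      · refine (hH.integrable (y := 1 / 2) (by norm_num) (B := Real.exp |t|) (by positivity) ?_ ?_).norm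
        · intro x
          rw [one_mul, norm_exp]
          have : Real.exp (t * (x + (1 / 2 : ℝ) * I) * I).re ≤ Real.exp |t| := by
            apply Real.exp_le_exp.2
            simp
            nlinarith [neg_abs_le t, abs_nonneg t]
          refine this.trans (le_mul_of_one_le_right (by positivity) ?_)
          nlinarith [sq_nonneg x]
        · exact (hline (fun _ => 1) (by fun_prop)).aestronglyMeasurable
      · intro n
        refine Eventually.of_forall fun x => ?_
        rw [norm_mul, norm_mul, norm_mul, norm_mul, norm_one]
        gcongr
        exact gb n _ (by simp)
      · refine Eventually.of_forall fun x => ?_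
        refine Tendsto.const_mul _ (Tendsto.mul_const _ (g1 _ (by simp) ?_))
        rintro ⟨x', -, hx'⟩
        have := congrArg Complex.im hx'
        norm_num at this
    have hl := (((hlim ν1 i1).sub (hlim ν2 i2))).add (((hlim ν3 i3).sub (hlim ν4 i4)).const_mul I)
    have hl2 := hl.congr (fun n => hval (g n) (gd n) (gb n))
    have huniq := tendsto_nhds_unique hl2 hr
    have hone := hval (fun _ => 1) (by fun_prop) (by simp)
    rw [hsplit ν1 i1, hsplit ν2 i2, hsplit ν3 i3, hsplit ν4 i4]
    linear_combination hone - huniq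
  have hKap : ∀ (ν ν' : Measure ℝ) (K : Set ℝ), ν.restrict K = ν'.restrict K → ν K = ν' K := by
    intro ν ν' K h
    rw [← Measure.restrict_apply_univ, h, Measure.restrict_apply_univ]
  obtain ⟨ρ, hρ, hρf⟩ := density_diff ν1 ν2 (fun K h h0 => hKap _ _ _ (hK K h h0).1)
  obtain ⟨σ, hσ, hσf⟩ := density_diff ν3 ν4 (fun K h h0 => hKap _ _ _ (hK K h h0).2)
  refine ⟨fun x => ρ x + I * σ x, hρ.ofReal.add (hσ.ofReal.const_mul I), fun f hf hfB => ?_⟩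
  convert hM f hf hfB using 2
  rw [hρf f hf hfB, hσf f hf hfB]
  obtain ⟨B, hB⟩ := hfB
  have e : ∀ r : ℝ → ℝ, Integrable r → Integrable (fun x => (r x : ℂ) * f x) := fun r hr =>
    (hr.ofReal (𝕜 := ℂ)).mul_bdd (c := B) hf.aestronglyMeasurable (Eventually.of_forall hB)
  rw [← integral_const_mul, ← integral_add (e ρ hρ) ((e σ hσ).const_mul I)]
  simp only [add_mul, mul_assoc]

open FourierTransform in
lemma integral_fourier_mul (f : ℝ → ℂ) (hf : Integrable f) (φ : SchwartzMap ℝ ℂ) :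
    ∫ x, f x * φ x = ∫ ξ, 𝓕 f ξ * (𝓕⁻ φ : SchwartzMap ℝ ℂ) ξ := by
  have h := VectorFourier.integral_fourierIntegral_smul_eq_flip (μ := volume) (ν := volume)
    (L := innerₗ ℝ) (f := f) (g := (𝓕⁻ φ : SchwartzMap ℝ ℂ)) Real.continuous_fourierChar continuous_inner hf
    (𝓕⁻ φ : SchwartzMap ℝ ℂ).integrable
  rw [flip_innerₗ] at h
  simp only [smul_eq_mul] at h
  refine Eq.trans ?_ h.symm
  refine integral_congr_ae (Eventually.of_forall fun x => ?_)
  simp only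
  congr 1
  have : (𝓕 (𝓕⁻ φ : SchwartzMap ℝ ℂ) : SchwartzMap ℝ ℂ) = φ := fourier_fourierInv_eq φ
  conv_lhs => rw [← this]
  rw [SchwartzMap.fourier_coe]
  rfl

lemma WB.int1 {C : ℝ≥0∞} {H : ℂ → ℂ} (hH : WB (fun x => 1 + x ^ 2) C H) {y : ℝ} (hy : y ∈ Ioo (0:ℝ) 1) :
    Integrable (fun x : ℝ => H (x + y * I)) := by
  have := hH.integrable hy (g := fun _ => 1) (B := 1) zero_le_one
    (fun x => by rw [norm_one, one_mul]; nlinarith [sq_nonneg x]) aestronglyMeasurable_const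
  simpa using this

open FourierTransform in
lemma trace_H {C : ℝ≥0∞} {H : ℂ → ℂ} (hH : WB (fun x => 1 + x ^ 2) C H) :
    ∃ H0 : ℝ → ℂ, Integrable H0 ∧ ∀ φ : SchwartzMap ℝ ℂ,
      Tendsto (fun y : ℝ => ∫ x : ℝ, H (x + y * I) * φ x) (𝓝[>] 0) (𝓝 (∫ x, H0 x * φ x)) := by
  obtain ⟨H0, hi, hH0⟩ := fm_riesz hH (Ultrafilter.of (𝓝[>] (0:ℝ))) (Ultrafilter.of_le _)
  refine ⟨H0, hi, fun φ => ?_⟩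
  rw [integral_fourier_mul H0 hi]
  have hmem : Ioo (0:ℝ) 1 ∈ 𝓝[>] (0:ℝ) := Ioo_mem_nhdsGT (by norm_num)
  have hF : ∀ (f : ℝ → ℂ) (ξ : ℝ), 𝓕 f ξ = ∫ x : ℝ, f x * cexp ((-2 * π * ξ : ℝ) * x * I) := by
    intro f ξ
    rw [Real.fourier_real_eq_integral_exp_smul]
    refine integral_congr_ae (Eventually.of_forall fun x => ?_)
    simp only [smul_eq_mul]
    rw [mul_comm]
    congr 2
    push_cast
    ring
  have hlim : ∀ ξ : ℝ, Tendsto (fun y : ℝ => 𝓕 (fun x : ℝ => H (x + y * I)) ξ) (𝓝[>] 0) (𝓝 (𝓕 H0 ξ)) := by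
    intro ξ
    simp only [hF]
    set t : ℝ := -2 * π * ξ
    have hb1 : ∀ z : ℂ, 0 ≤ z.im → z.im ≤ 1 → ‖cexp (t * z * I)‖ ≤ Real.exp |t| := by
      intro z h0 h1
      rw [norm_exp]
      refine Real.exp_le_exp.2 ?_
      simp
      nlinarith [neg_abs_le t, abs_nonneg t]
    have hT := hH0 (fun x : ℝ => cexp (t * x * I)) (by fun_prop)
      ⟨Real.exp |t|, fun x => hb1 x (by simp) (by simp)⟩
    have hT2 := (hH.limit0 (c := 0) (B := Real.exp |t|) (ψ := fun z => cexp (t * z * I))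
      (by positivity) (by fun_prop) ?_)
    · simp only [ofReal_zero, zero_mul, add_zero, zero_add] at hT2
      have := tendsto_nhds_unique hT (hT2.mono_left (Ultrafilter.of_le _))
      rw [this]
      exact hT2
    · intro z h0 h1
      refine (hb1 z h0 (by linarith)).trans (le_mul_of_one_le_right (by positivity) ?_)
      nlinarith [sq_nonneg z.re]
  have hmain : Tendsto (fun y : ℝ => ∫ ξ, 𝓕 (fun x : ℝ => H (x + y * I)) ξ * (𝓕⁻ φ : SchwartzMap ℝ ℂ) ξ)
      (𝓝[>] 0) (𝓝 (∫ ξ, 𝓕 H0 ξ * (𝓕⁻ φ : SchwartzMap ℝ ℂ) ξ)) := by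
    refine tendsto_integral_filter_of_dominated_convergence
      (fun ξ => C.toReal * ‖(𝓕⁻ φ : SchwartzMap ℝ ℂ) ξ‖) ?_ ?_ ?_ ?_
    · filter_upwards [hmem] with y hy
      refine Continuous.aestronglyMeasurable (Continuous.mul ?_ (𝓕⁻ φ : SchwartzMap ℝ ℂ).continuous)
      exact VectorFourier.fourierIntegral_continuous Real.continuous_fourierChar continuous_inner (hH.int1 hy)
    · filter_upwards [hmem] with y hy
      refine Eventually.of_forall fun ξ => ?_
      rw [norm_mul]
      gcongr
      refine (VectorFourier.norm_fourierIntegral_le_integral_norm _ _ _ _ _).trans ?_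
      rw [integral_norm_eq_lintegral_enorm (hH.int1 hy).aestronglyMeasurable]
      refine ENNReal.toReal_mono hH.fin ((lintegral_mono fun x => ?_).trans (hH.bd y hy))
      refine le_mul_of_one_le_right (by positivity) ?_
      rw [ENNReal.one_le_ofReal]
      nlinarith [sq_nonneg x]
    · exact (𝓕⁻ φ : SchwartzMap ℝ ℂ).integrable.norm.const_mul _
    · exact Eventually.of_forall fun ξ => (hlim ξ).mul_const _
  refine hmain.congr' ?_
  filter_upwards [hmem] with y hy
  exact (integral_fourier_mul _ (hH.int1 hy) φ).symm

structure TrP (G : ℂ → ℂ) (g : ℝ → ℂ) : Prop where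
  int : ∀ y ∈ Ioo (0:ℝ) 1, ∀ φ : SchwartzMap ℝ ℂ, Integrable (fun x : ℝ => G (x + y * I) * φ x)
  lim : ∀ φ : SchwartzMap ℝ ℂ,
      Tendsto (fun y : ℝ => ∫ x : ℝ, G (x + y * I) * φ x) (𝓝[>] 0) (𝓝 (∫ x, g x * φ x))
  loc : LocallyIntegrable g

lemma TrP.step {G : ℂ → ℂ} {g : ℝ → ℂ} (h : TrP G g) :
    TrP (fun z => (z + I) * G z) (fun x => (x + I) * g x) := by
  have htg : Function.HasTemperateGrowth (fun x : ℝ => (x : ℂ) + I) := by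
    have h1 : Function.HasTemperateGrowth (fun x : ℝ => (x : ℂ)) :=
      (Complex.ofRealCLM).hasTemperateGrowth
    exact h1.add (Function.HasTemperateGrowth.const I)
  let S : SchwartzMap ℝ ℂ → SchwartzMap ℝ ℂ := fun φ => SchwartzMap.smulLeftCLM ℂ (fun x : ℝ => (x : ℂ) + I) φ
  have hS : ∀ φ x, S φ x = ((x : ℂ) + I) * φ x := fun φ x => by
    simp only [S]; rw [SchwartzMap.smulLeftCLM_apply_apply htg, smul_eq_mul]
  have hid : ∀ (φ : SchwartzMap ℝ ℂ) (y x : ℝ), ((x + y * I : ℂ) + I) * G (x + y * I) * φ x =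
      G (x + y * I) * S φ x + (y * I) * (G (x + y * I) * φ x) := by
    intro φ y x
    rw [hS]; ring
  refine ⟨fun y hy φ => ?_, fun φ => ?_, ?_⟩
  · simp only [hid]
    exact (h.int y hy (S φ)).add ((h.int y hy φ).const_mul _)
  · have h1 : Tendsto (fun y : ℝ => (∫ x : ℝ, G (x + y * I) * S φ x) + (y * I) * ∫ x : ℝ, G (x + y * I) * φ x)
        (𝓝[>] 0) (𝓝 ((∫ x, g x * S φ x) + (((0 : ℝ) : ℂ) * I) * ∫ x, g x * φ x)) := by
      refine (h.lim (S φ)).add (Tendsto.mul ?_ (h.lim φ))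
      have : Continuous (fun y : ℝ => (y : ℂ) * I) := by fun_prop
      exact (this.tendsto 0).mono_left nhdsWithin_le_nhds
    have e : ∫ x : ℝ, ((x : ℂ) + I) * g x * φ x = (∫ x, g x * S φ x) + (((0 : ℝ) : ℂ) * I) * ∫ x, g x * φ x := by
      simp only [hS, ofReal_zero, zero_mul, add_zero]
      refine integral_congr_ae (Eventually.of_forall fun x => ?_)
      simp only; ring
    rw [e]
    refine h1.congr' ?_
    filter_upwards [Ioo_mem_nhdsGT (show (0:ℝ) < 1 by norm_num)] with y hy
    rw [← integral_const_mul, ← integral_add (h.int y hy _) ((h.int y hy φ).const_mul _)]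
    exact integral_congr_ae (Eventually.of_forall fun x => (hid φ y x).symm)
  · have hc : Continuous (fun x : ℝ => (x : ℂ) + I) := by fun_prop
    exact h.loc.continuous_mul hc

lemma trace_h {C : ℝ≥0∞} {h : ℂ → ℂ} (hh : WB (fun x => (1 + x ^ 2)⁻¹) C h) :
    ∃ h0 : ℝ → ℂ, TrP h h0 := by
  have hne : ∀ z : ℂ, 0 < z.im → z + I ≠ 0 := fun z hz h => by
    have := congrArg Complex.im h
    simp at this; linarith
  have hH : WB (fun x => 1 + x ^ 2) C (fun z => h z / (z + I) ^ 4) := by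
    refine ⟨?_, by fun_prop, hh.fin, fun y hy => (lintegral_mono fun x => ?_).trans (hh.bd y hy)⟩
    · refine hh.diff.div (by fun_prop) (fun z hz => pow_ne_zero _ (hne z hz.1))
    · simp only
      rw [← ofReal_norm, ← ofReal_norm, ← ENNReal.ofReal_mul (norm_nonneg _), ← ENNReal.ofReal_mul (norm_nonneg _)]
      apply ENNReal.ofReal_le_ofReal
      rw [norm_div, norm_pow]
      have h2 : 1 + x ^ 2 ≤ ‖(x + y * I + I : ℂ)‖ ^ 2 := by
        rw [← normSq_eq_norm_sq, normSq_apply]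
        simp
        nlinarith [hy.1]
      have h4 : (1 + x ^ 2) ^ 2 ≤ ‖(x + y * I + I : ℂ)‖ ^ 4 := by
        calc (1 + x ^ 2) ^ 2 ≤ (‖(x + y * I + I : ℂ)‖ ^ 2) ^ 2 := by gcongr
          _ = _ := by ring
      have h5 : (0:ℝ) < 1 + x ^ 2 := by positivity
      rw [div_mul_eq_mul_div, ← div_eq_mul_inv, div_le_div_iff₀ (lt_of_lt_of_le (by positivity) h4) h5]
      nlinarith [mul_le_mul_of_nonneg_left h4 (norm_nonneg (h (x + y * I)))]
  obtain ⟨H0, hi, hlim⟩ := trace_H hH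
  have t0 : TrP (fun z => h z / (z + I) ^ 4) H0 := by
    refine ⟨fun y hy φ => ?_, hlim, hi.locallyIntegrable⟩
    obtain ⟨B, hB⟩ : ∃ B, ∀ x, ‖φ x‖ ≤ B := by
      obtain ⟨B, hB⟩ := φ.decay 0 0
      exact ⟨B, fun x => by simpa using hB.2 x⟩
    exact (hH.int1 hy).mul_bdd (c := B) φ.continuous.aestronglyMeasurable (Eventually.of_forall hB)
  have t4 := t0.step.step.step.step
  refine ⟨_, ?_, ?_, t4.loc⟩
  · intro y hy φ
    refine (t4.int y hy φ).congr (Eventually.of_forall fun x => ?_)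
    have := hne (x + y * I) (by simpa using hy.1)
    simp only
    field_simp
  · intro φ
    refine (t4.lim φ).congr' ?_
    filter_upwards [Ioo_mem_nhdsGT (show (0:ℝ) < 1 by norm_num)] with y hy
    refine integral_congr_ae (Eventually.of_forall fun x => ?_)
    have := hne (x + y * I) (by simpa using hy.1)
    simp only
    field_simp

def Spl (p q N : ℝ≥0∞) (h : ℂ → ℂ) : Prop := ∀ y ∈ Ioo (0:ℝ) 1, ∃ f g : ℝ → ℂ,
  Measurable f ∧ Measurable g ∧ f + g = bLine h y ∧
    eLpNorm f p volume ≤ ENNReal.ofReal (1 - y) * N ∧ eLpNorm g q volume ≤ ENNReal.ofReal y * N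

lemma spl_of_hardyNorm {p q N : ℝ≥0∞} {h : ℂ → ℂ} (hN : hardyNorm p q h < N) : Spl p q N h := by
  intro y hy
  have h1 := lt_of_le_of_lt (le_iSup₂ (f := fun (y : ℝ) (_ : y ∈ Ioo (0:ℝ) 1) =>
    ⨅ (f : ℝ → ℂ) (g : ℝ → ℂ) (_ : Measurable f) (_ : Measurable g)
      (_ : f + g = bLine h y),
      ENNReal.ofReal (1 - y)⁻¹ * eLpNorm f p volume +
        ENNReal.ofReal y⁻¹ * eLpNorm g q volume) y hy) hN
  simp only [iInf_lt_iff] at h1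
  obtain ⟨f, g, hf, hg, hfg, hlt⟩ := h1
  have hinv : ∀ (a : ℝ) (e : ℝ≥0∞), 0 < a → ENNReal.ofReal a⁻¹ * e ≤ N → e ≤ ENNReal.ofReal a * N := by
    intro a e ha he
    calc e = ENNReal.ofReal a * (ENNReal.ofReal a⁻¹ * e) := by
          rw [← mul_assoc, ← ENNReal.ofReal_mul ha.le, mul_inv_cancel₀ ha.ne', ENNReal.ofReal_one, one_mul]
      _ ≤ _ := by gcongr
  exact ⟨f, g, hf, hg, hfg, hinv _ _ (by linarith [hy.2]) (le_self_add.trans hlt.le),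
    hinv _ _ hy.1 (le_add_self.trans hlt.le)⟩

lemma lint_weight (q : ℝ≥0∞) (hq : 1 ≤ q) : ∃ D : ℝ≥0∞, D ≠ ⊤ ∧ ∀ g : ℝ → ℂ, Measurable g →
    ∫⁻ x, ‖g x‖ₑ * ENNReal.ofReal ((1 + x ^ 2)⁻¹) ≤ eLpNorm g q volume * D := by
  let m : Measure ℝ := volume.withDensity (fun x => ENNReal.ofReal ((1 + x ^ 2)⁻¹))
  have hwm : Measurable (fun x : ℝ => ENNReal.ofReal ((1 + x ^ 2)⁻¹)) := by fun_prop
  have hm : m ≤ volume := by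
    conv_rhs => rw [← withDensity_one (μ := (volume : Measure ℝ))]
    refine withDensity_mono (Eventually.of_forall fun x => ?_)
    simp only [Pi.one_apply]
    rw [ENNReal.ofReal_le_one]
    apply inv_le_one_of_one_le₀
    nlinarith [sq_nonneg x]
  have hfin : m univ ≠ ⊤ := by
    rw [withDensity_apply _ MeasurableSet.univ, Measure.restrict_univ]
    exact (integrable_inv_one_add_sq.lintegral_lt_top).ne
  refine ⟨m univ ^ (1 / (1:ℝ≥0∞).toReal - 1 / q.toReal), ?_, fun g hg => ?_⟩
  · apply ENNReal.rpow_ne_top_of_nonneg _ hfin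
    rcases eq_or_ne q ⊤ with rfl | hqt
    · simp
    · have : 1 ≤ q.toReal := by
        rw [← ENNReal.toReal_one]; exact ENNReal.toReal_mono hqt hq
      simp
      exact inv_le_one_of_one_le₀ this
  · have h1 := eLpNorm_le_eLpNorm_mul_rpow_measure_univ (μ := m) hq hg.aestronglyMeasurable
    rw [eLpNorm_one_eq_lintegral_enorm, lintegral_withDensity_eq_lintegral_mul _ hwm hg.enorm] at h1
    have h2 : ∫⁻ x, ‖g x‖ₑ * ENNReal.ofReal ((1 + x ^ 2)⁻¹) =
        ∫⁻ x, ((fun x : ℝ => ENNReal.ofReal ((1 + x ^ 2)⁻¹)) * fun x => ‖g x‖ₑ) x :=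
      lintegral_congr fun x => by rw [Pi.mul_apply, mul_comm]
    rw [h2]
    exact h1.trans (mul_le_mul_left (eLpNorm_mono_measure _ hm) _)

lemma Spl.wb {p q N : ℝ≥0∞} {h : ℂ → ℂ} (hs : Spl p q N h) (hp : 1 ≤ p) (hq : 1 ≤ q) (hN : N ≠ ⊤)
    (hd : DifferentiableOn ℂ h Strip) : ∃ C, WB (fun x => (1 + x ^ 2)⁻¹) C h := by
  obtain ⟨D, hD, hDf⟩ := lint_weight p hp
  obtain ⟨E, hE, hEg⟩ := lint_weight q hq
  refine ⟨N * D + N * E, hd, by fun_prop, by finiteness, fun y hy => ?_⟩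
  obtain ⟨f, g, hf, hg, hfg, hfN, hgN⟩ := hs y hy
  have e : ∀ x : ℝ, h (x + y * I) = f x + g x := fun x => (congrFun hfg x).symm
  calc ∫⁻ x : ℝ, ‖h (x + y * I)‖ₑ * ENNReal.ofReal ((1 + x ^ 2)⁻¹)
      ≤ ∫⁻ x : ℝ, (‖f x‖ₑ * ENNReal.ofReal ((1 + x ^ 2)⁻¹) + ‖g x‖ₑ * ENNReal.ofReal ((1 + x ^ 2)⁻¹)) := by
        refine lintegral_mono fun x => ?_
        rw [e, ← add_mul]
        gcongr
        exact enorm_add_le _ _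
    _ = (∫⁻ x : ℝ, ‖f x‖ₑ * ENNReal.ofReal ((1 + x ^ 2)⁻¹)) + ∫⁻ x : ℝ, ‖g x‖ₑ * ENNReal.ofReal ((1 + x ^ 2)⁻¹) := by
        rw [lintegral_add_left]
        fun_prop
    _ ≤ (ENNReal.ofReal (1 - y) * N) * D + (ENNReal.ofReal y * N) * E :=
        add_le_add ((hDf f hf).trans (mul_le_mul_left hfN _)) ((hEg g hg).trans (mul_le_mul_left hgN _))
    _ ≤ (1 * N) * D + (1 * N) * E := by
        gcongr
        · rw [ENNReal.ofReal_le_one]; linarith [hy.1]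
        · rw [ENNReal.ofReal_le_one]; linarith [hy.2]
    _ = _ := by simp

lemma young (p : ℝ≥0∞) (hp : 1 ≤ p) (φ : ℝ → ℝ) (hφ : Continuous φ) (h0 : ∀ x, 0 ≤ φ x)
    (hi : Integrable φ) (h1 : ∫ x, φ x = 1) (f : ℝ → ℂ) (hf : Measurable f) :
    eLpNorm (fun x => ∫ t, f t * (φ (x - t) : ℂ)) p volume ≤ eLpNorm f p volume := by
  let μ : ℝ → Measure ℝ := fun x => volume.withDensity (fun t => ENNReal.ofReal (φ (x - t)))
  have hm : ∀ x, Measurable (fun t => ENNReal.ofReal (φ (x - t))) := fun x => by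
    have : Measurable φ := hφ.measurable
    fun_prop
  have hl1 : ∫⁻ t, ENNReal.ofReal (φ t) = 1 := by
    rw [← ofReal_integral_eq_lintegral_ofReal hi (Eventually.of_forall h0), h1, ENNReal.ofReal_one]
  have hprob : ∀ x, IsProbabilityMeasure (μ x) := fun x => ⟨by
    rw [withDensity_apply _ MeasurableSet.univ, Measure.restrict_univ,
      lintegral_sub_left_eq_self (fun t => ENNReal.ofReal (φ t)) x, hl1]⟩
  have hpt : ∀ x, ‖∫ t, f t * (φ (x - t) : ℂ)‖ₑ ≤ eLpNorm f p (μ x) := by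
    intro x
    have := hprob x
    refine le_trans ?_ (eLpNorm_le_eLpNorm_of_exponent_le hp hf.aestronglyMeasurable)
    rw [eLpNorm_one_eq_lintegral_enorm, lintegral_withDensity_eq_lintegral_mul _ (hm x) hf.enorm]
    refine (enorm_integral_le_lintegral_enorm _).trans (lintegral_mono fun t => ?_)
    rw [enorm_mul, Pi.mul_apply, mul_comm, ← ofReal_norm (φ (x - t) : ℂ), norm_real,
      Real.norm_of_nonneg (h0 _)]
  rcases eq_or_ne p ⊤ with rfl | hpt'
  · rw [eLpNorm_exponent_top, eLpNorm_exponent_top]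
    refine essSup_le_of_ae_le _ (Eventually.of_forall fun x => (hpt x).trans ?_)
    rw [eLpNorm_exponent_top]
    exact eLpNormEssSup_mono_measure _ (withDensity_absolutelyContinuous _ _)
  · have hp0 : p ≠ 0 := (zero_lt_one.trans_le hp).ne'
    have hpp : 0 < p.toReal := ENNReal.toReal_pos hp0 hpt'
    rw [eLpNorm_eq_lintegral_rpow_enorm_toReal hp0 hpt', eLpNorm_eq_lintegral_rpow_enorm_toReal hp0 hpt']
    apply ENNReal.rpow_le_rpow _ (by positivity)
    calc ∫⁻ x, ‖∫ t, f t * (φ (x - t) : ℂ)‖ₑ ^ p.toReal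
        ≤ ∫⁻ x, ∫⁻ t, ENNReal.ofReal (φ (x - t)) * ‖f t‖ₑ ^ p.toReal := by
          refine lintegral_mono fun x => ?_
          refine (ENNReal.rpow_le_rpow (hpt x) hpp.le).trans ?_
          rw [eLpNorm_eq_lintegral_rpow_enorm_toReal hp0 hpt', ← ENNReal.rpow_mul,
            one_div_mul_cancel hpp.ne', ENNReal.rpow_one,
            lintegral_withDensity_eq_lintegral_mul _ (hm x) (hf.enorm.pow_const _)]
          rfl
      _ = ∫⁻ t, ∫⁻ x, ENNReal.ofReal (φ (x - t)) * ‖f t‖ₑ ^ p.toReal := by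
          apply lintegral_lintegral_swap
          have : Measurable φ := hφ.measurable
          exact Measurable.aemeasurable (by fun_prop)
      _ = ∫⁻ t, ‖f t‖ₑ ^ p.toReal := by
          refine lintegral_congr fun t => ?_
          rw [lintegral_mul_const'' _ (by have : Measurable φ := hφ.measurable
                                          exact Measurable.aemeasurable (by fun_prop)),
            lintegral_sub_right_eq_self (fun x => ENNReal.ofReal (φ x)) t, hl1, one_mul]

lemma sch_bound (φ : SchwartzMap ℝ ℂ) : ∃ B : ℝ, 0 ≤ B ∧ ∀ x, ‖φ x‖ ≤ B * (1 + x ^ 2)⁻¹ := by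
  obtain ⟨B, hB⟩ := φ.decay 0 0
  obtain ⟨D, hD⟩ := φ.decay 2 0
  refine ⟨B + D, by linarith [hB.1, hD.1], fun x => ?_⟩
  have h1 := hB.2 x
  have h2 := hD.2 x
  simp at h1 h2
  rw [← div_eq_mul_inv, le_div_iff₀ (by positivity)]
  nlinarith

lemma trace_Lp {p q N : ℝ≥0∞} {h : ℂ → ℂ} {h0 : ℝ → ℂ} (hs : Spl p q N h) (hp : 1 ≤ p) (hq : 1 ≤ q)
    (hN : N ≠ ⊤) (ht : TrP h h0) : eLpNorm h0 p volume ≤ N := by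
  obtain ⟨D, hD, hDg⟩ := lint_weight q hq
  obtain ⟨E, hE, hEg⟩ := lint_weight p hp
  let y : ℕ → ℝ := fun n => 1 / ((n : ℝ) + 2)
  have hy : ∀ n, y n ∈ Ioo (0:ℝ) 1 := fun n => by
    refine ⟨by positivity, ?_⟩
    rw [div_lt_one (by positivity)]
    have : (0:ℝ) ≤ n := by positivity
    linarith
  have hy0 : Tendsto y atTop (𝓝 0) := by
    have := tendsto_one_div_add_atTop_nhds_zero_nat (𝕜 := ℝ)
    have h2 := (tendsto_add_atTop_iff_nat 1).2 this
    refine h2.congr fun n => ?_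
    simp only [y]; push_cast; ring_nf
  have hyw : Tendsto y atTop (𝓝[>] 0) :=
    tendsto_nhdsWithin_iff.2 ⟨hy0, Eventually.of_forall fun n => (hy n).1⟩
  choose f g hf hg hfg hfN hgN using fun n => hs (y n) (hy n)
  have key : ∀ φ : ContDiffBump (0:ℝ), 
      eLpNorm (fun x => ∫ t, h0 t * (φ.normed volume (x - t) : ℂ)) p volume ≤ N := by
    intro φ
    have hk : ∀ x : ℝ, ∃ k : SchwartzMap ℝ ℂ, ∀ t, k t = (φ.normed volume (x - t) : ℂ) := by
      intro x
      have hcd : ContDiff ℝ (⊤ : ℕ∞) (fun t : ℝ => (φ.normed volume (x - t) : ℂ)) := by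
        have h1 : ContDiff ℝ (⊤ : ℕ∞) (fun t : ℝ => φ.normed volume (x - t)) :=
          φ.contDiff_normed.comp (contDiff_const.sub contDiff_id)
        exact ofRealCLM.contDiff.comp h1
      have hcs : HasCompactSupport (fun t : ℝ => (φ.normed volume (x - t) : ℂ)) := by
        have h1 : HasCompactSupport (fun t : ℝ => φ.normed volume (x - t)) :=
          φ.hasCompactSupport_normed.comp_homeomorph (Homeomorph.subLeft x)
        exact h1.comp_left (g := fun r : ℝ => (r : ℂ)) (by simp)
      exact ⟨hcs.toSchwartzMap hcd, fun t => rfl⟩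
    have hmeas : ∀ n, AEStronglyMeasurable (fun x => ∫ t, f n t * (φ.normed volume (x - t) : ℂ)) := by
      intro n
      have hm : Measurable (φ.normed (volume : Measure ℝ)) := φ.continuous_normed.measurable
      have : StronglyMeasurable (fun z : ℝ × ℝ => f n z.2 * (φ.normed volume (z.1 - z.2) : ℂ)) := by
        have := hf n
        exact Measurable.stronglyMeasurable (by fun_prop)
      exact this.integral_prod_right.aestronglyMeasurable
    refine (Lp.eLpNorm_lim_le_liminf_eLpNorm hmeas _ (Eventually.of_forall fun x => ?_)).trans ?_
    · obtain ⟨k, hk⟩ := hk x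
      simp only [← hk]
      obtain ⟨B, hB0, hB⟩ := sch_bound k
      have hbd : ∀ (u : ℝ → ℂ) (r : ℝ≥0∞) (D : ℝ≥0∞), Measurable u →
          (∀ g : ℝ → ℂ, Measurable g → ∫⁻ x, ‖g x‖ₑ * ENNReal.ofReal ((1 + x ^ 2)⁻¹) ≤ eLpNorm g r volume * D) →
          ∫⁻ t, ‖u t * k t‖ₑ ≤ ENNReal.ofReal B * (eLpNorm u r volume * D) := by
        intro u r D hu hDu
        refine le_trans ?_ (mul_le_mul_right (hDu u hu) _)
        rw [← lintegral_const_mul' _ _ ENNReal.ofReal_ne_top]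
        refine lintegral_mono fun t => ?_
        rw [enorm_mul, mul_left_comm, ← ENNReal.ofReal_mul hB0]
        gcongr
        rw [← ofReal_norm]
        exact ENNReal.ofReal_le_ofReal (hB t)
      have hint : ∀ (u : ℝ → ℂ) (r : ℝ≥0∞) (D : ℝ≥0∞), Measurable u → D ≠ ⊤ → eLpNorm u r volume ≠ ⊤ →
          (∀ g : ℝ → ℂ, Measurable g → ∫⁻ x, ‖g x‖ₑ * ENNReal.ofReal ((1 + x ^ 2)⁻¹) ≤ eLpNorm g r volume * D) →
          Integrable (fun t => u t * k t) := by
        intro u r D hu hD hur hDu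
        refine ⟨hu.aestronglyMeasurable.mul k.continuous.aestronglyMeasurable, ?_⟩
        refine lt_of_le_of_lt (hbd u r D hu hDu) ?_
        exact (by finiteness : ENNReal.ofReal B * (eLpNorm u r volume * D) ≠ ⊤).lt_top
      have hlim := (ht.lim k).comp hyw
      have hg0 : Tendsto (fun n => ∫ t, g n t * k t) atTop (𝓝 0) := by
        rw [tendsto_zero_iff_enorm_tendsto_zero]
        refine tendsto_of_tendsto_of_tendsto_of_le_of_le tendsto_const_nhds
          (h := fun n => ENNReal.ofReal B * (ENNReal.ofReal (y n) * N * D)) ?_ (fun n => zero_le) (fun n => ?_)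
        · have h1 : Tendsto (fun n => ENNReal.ofReal (y n)) atTop (𝓝 0) := by
            have h3 := (ENNReal.continuous_ofReal.tendsto 0).comp hy0
            rw [ENNReal.ofReal_zero] at h3
            exact h3
          have h2 := ENNReal.Tendsto.const_mul (a := ENNReal.ofReal B)
            (ENNReal.Tendsto.mul_const (b := D) (ENNReal.Tendsto.mul_const (b := N) h1 (Or.inr hN)) (Or.inr hD))
            (Or.inr ENNReal.ofReal_ne_top)
          simpa using h2
        · refine (enorm_integral_le_lintegral_enorm _).trans ((hbd _ q D (hg n) hDg).trans ?_)
          exact mul_le_mul_right (mul_le_mul_left (hgN n) _) _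
      have := hlim.sub hg0
      rw [sub_zero] at this
      refine this.congr fun n => ?_
      simp only [Function.comp_apply]
      have hfi := hint (f n) p E (hf n) hE (ne_top_of_le_ne_top (by finiteness) (hfN n)) hEg
      have hgi := hint (g n) q D (hg n) hD (ne_top_of_le_ne_top (by finiteness) (hgN n)) hDg
      rw [sub_eq_iff_eq_add, ← integral_add hfi hgi]
      refine integral_congr_ae (Eventually.of_forall fun t => ?_)
      have e : h (t + y n * I) = f n t + g n t := (congrFun (hfg n) t).symm
      simp only [e, add_mul]
    · refine liminf_le_of_le (by isBoundedDefault) (fun b hb => ?_)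
      obtain ⟨n, hn⟩ := hb.exists
      refine hn.trans ((young p hp _ φ.continuous_normed φ.nonneg_normed φ.integrable_normed
        φ.integral_normed (f n) (hf n)).trans ((hfN n).trans ?_))
      calc _ ≤ 1 * N := by
            gcongr
            rw [ENNReal.ofReal_le_one]; linarith [(hy n).1]
        _ = N := one_mul N
  let φ : ℕ → ContDiffBump (0:ℝ) := fun n => ⟨y n, 2 * y n, (hy n).1, by linarith [(hy n).1]⟩
  have hconv := ContDiffBump.ae_convolution_tendsto_right_of_locallyIntegrable (μ := volume) (φ := φ)
    (l := atTop) (K := 2) (g := h0) (by simpa [φ] using hy0.const_mul 2) (Eventually.of_forall fun n => le_rfl) ht.loc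
  have heq : ∀ n x, convolution ((φ n).normed volume) h0 (ContinuousLinearMap.lsmul ℝ ℝ) volume x =
      ∫ t, h0 t * ((φ n).normed volume (x - t) : ℂ) := by
    intro n x
    rw [convolution_def, ← integral_sub_left_eq_self _ _ x]
    refine integral_congr_ae (Eventually.of_forall fun t => ?_)
    simp [mul_comm]
  simp only [heq] at hconv
  refine (Lp.eLpNorm_lim_le_liminf_eLpNorm (fun n => ?_) _ hconv).trans ?_
  · have : Continuous (convolution ((φ n).normed volume) h0 (ContinuousLinearMap.lsmul ℝ ℝ) volume) :=
      (φ n).hasCompactSupport_normed.continuous_convolution_left _ (φ n).continuous_normed ht.loc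
    have e := funext (heq n)
    rw [e] at this
    exact this.aestronglyMeasurable
  · refine liminf_le_of_le (by isBoundedDefault) (fun b hb => ?_)
    obtain ⟨n, hn⟩ := hb.exists
    exact hn.trans (key (φ n))

def PhiF (φ : ℝ → ℂ) (z : ℂ) : ℂ := ∫ k : ℝ, φ k * cexp (-(I * k * z))

lemma PhiF_norm_le (φ : ℝ → ℂ) (hφ : Continuous φ) (hc : HasCompactSupport φ) {z : ℂ} (hz : |z.im| ≤ 1) :
    ‖PhiF φ z‖ ≤ ∫ k, ‖φ k‖ * Real.exp |k| := by
  refine norm_integral_le_of_norm_le ?_ (Eventually.of_forall fun k => ?_)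
  · refine Continuous.integrable_of_hasCompactSupport (by fun_prop) ?_
    exact hc.norm.mul_right
  · rw [norm_mul, norm_exp]
    gcongr
    simp
    calc k * z.im ≤ |k * z.im| := le_abs_self _
      _ = |k| * |z.im| := abs_mul _ _
      _ ≤ |k| * 1 := by gcongr
      _ = |k| := mul_one _

lemma PhiF_deriv (φ : ℝ → ℂ) (hφ : ContDiff ℝ (⊤ : ℕ∞) φ) (hc : HasCompactSupport φ) (z : ℂ) :
    PhiF (deriv φ) z = I * z * PhiF φ z := by
  have hd : ∀ k : ℝ, HasDerivAt (fun k : ℝ => cexp (-(I * k * z))) (-(I * z) * cexp (-(I * k * z))) k := by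
    intro k
    have h1 : HasDerivAt (fun k : ℝ => -(I * (k : ℂ) * z)) (-(I * z)) k := by
      have := ((Complex.ofRealCLM.hasDerivAt (x := k)).const_mul I).mul_const z
      have h2 := this.neg
      simp only [ofRealCLM_apply, ofReal_one, mul_one] at h2
      exact h2
    have := h1.cexp
    rwa [mul_comm (cexp _)] at this
  have hφd : ∀ k, HasDerivAt φ (deriv φ k) k := fun k =>
    ((hφ.differentiable (by simp)) k).hasDerivAt
  have hφc := hφ.continuous
  have hφ'c : Continuous (deriv φ) := hφ.continuous_deriv (by simp)
  have := integral_mul_deriv_eq_deriv_mul_of_integrable (u := φ) (u' := deriv φ)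
    (v := fun k : ℝ => cexp (-(I * k * z))) (v' := fun k : ℝ => -(I * z) * cexp (-(I * k * z)))
    (fun k _ => hφd k) (fun k _ => hd k)
    (Continuous.integrable_of_hasCompactSupport (by fun_prop) hc.mul_right)
    (Continuous.integrable_of_hasCompactSupport (by fun_prop) hc.deriv.mul_right)
    (Continuous.integrable_of_hasCompactSupport (by fun_prop) hc.mul_right)
  unfold PhiF
  have e : ∫ k : ℝ, φ k * (-(I * z) * cexp (-(I * k * z))) = -(I * z) * ∫ k : ℝ, φ k * cexp (-(I * k * z)) := by
    rw [← integral_const_mul]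
    refine integral_congr_ae (Eventually.of_forall fun k => ?_)
    simp only; ring
  rw [e] at this
  linear_combination this

lemma PhiF_bound (φ : ℝ → ℂ) (hφ : ContDiff ℝ (⊤ : ℕ∞) φ) (hc : HasCompactSupport φ) :
    ∃ B : ℝ, 0 ≤ B ∧ ∀ z : ℂ, |z.im| ≤ 1 → ‖PhiF φ z‖ ≤ B * (1 + z.re ^ 2)⁻¹ := by
  have hφ' : ContDiff ℝ (⊤ : ℕ∞) (deriv φ) := ((contDiff_infty_iff_deriv (𝕜 := ℝ)).1 hφ).2
  have hφ'' : ContDiff ℝ (⊤ : ℕ∞) (deriv (deriv φ)) := ((contDiff_infty_iff_deriv (𝕜 := ℝ)).1 hφ').2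
  refine ⟨(∫ k, ‖φ k‖ * Real.exp |k|) + ∫ k, ‖deriv (deriv φ) k‖ * Real.exp |k|, ?_, fun z hz => ?_⟩
  · exact add_nonneg (integral_nonneg fun k => by positivity) (integral_nonneg fun k => by positivity)
  · have h1 := PhiF_norm_le φ hφ.continuous hc hz
    have h2 := PhiF_norm_le _ hφ''.continuous hc.deriv.deriv hz
    rw [PhiF_deriv _ hφ' hc.deriv, PhiF_deriv _ hφ hc] at h2
    simp only [norm_mul, norm_I, one_mul] at h2
    rw [← div_eq_mul_inv, le_div_iff₀ (by positivity)]
    have h3 : z.re ^ 2 ≤ ‖z‖ ^ 2 := by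
      rw [← sq_abs]; gcongr; exact abs_re_le_norm z
    nlinarith [mul_le_mul_of_nonneg_right h3 (norm_nonneg (PhiF φ z))]

lemma PhiF_diff (φ : ℝ → ℂ) (hφ : Continuous φ) (hc : HasCompactSupport φ) :
    Differentiable ℂ (PhiF φ) := by
  intro z0
  have := hasDerivAt_integral_of_dominated_loc_of_deriv_le (𝕜 := ℂ) (μ := volume)
    (F := fun (z : ℂ) (k : ℝ) => φ k * cexp (-(I * k * z)))
    (F' := fun (z : ℂ) (k : ℝ) => φ k * (-(I * k) * cexp (-(I * k * z)))) (x₀ := z0)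
    (s := Metric.ball z0 1) (bound := fun k => ‖φ k‖ * (|k| * Real.exp (|k| * (‖z0‖ + 1))))
    (Metric.ball_mem_nhds _ one_pos)
    (Eventually.of_forall fun z => Continuous.aestronglyMeasurable (by fun_prop))
    (Continuous.integrable_of_hasCompactSupport (by fun_prop) hc.mul_right)
    (Continuous.aestronglyMeasurable (by fun_prop))
    (Eventually.of_forall fun k z hz => ?_)
    (Continuous.integrable_of_hasCompactSupport (by fun_prop) hc.norm.mul_right)
    (Eventually.of_forall fun k z hz => ?_)
  · exact this.2.differentiableAt
  · rw [norm_mul, norm_mul, norm_exp]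
    have hz' : ‖z‖ ≤ ‖z0‖ + 1 := by
      have := norm_sub_norm_le z z0
      have h2 := mem_ball_iff_norm.1 hz
      linarith
    simp only [norm_neg, norm_mul, norm_I, one_mul, norm_real, Real.norm_eq_abs]
    gcongr
    refine (re_le_norm _).trans ?_
    simp only [norm_neg, norm_mul, norm_I, one_mul, norm_real, Real.norm_eq_abs]
    gcongr
  · refine HasDerivAt.const_mul _ ?_
    have h1 : HasDerivAt (fun z : ℂ => -(I * (k : ℂ) * z)) (-(I * k)) z := by
      have h2 := ((hasDerivAt_id z).const_mul (I * (k : ℂ))).neg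
      rw [mul_one] at h2
      exact h2
    have := h1.cexp
    rwa [mul_comm (cexp _)] at this

open FourierTransform in
lemma fInt_schwartz (χ : ℝ → ℂ) (hχ : ContDiff ℝ (⊤ : ℕ∞) χ) (hc : HasCompactSupport χ) :
    ∃ s : SchwartzMap ℝ ℂ, ∀ x, s x = fInt χ x := by
  have h2 : (2 * π)⁻¹ ≠ 0 := by positivity
  refine ⟨SchwartzMap.compCLMOfContinuousLinearEquiv ℝ
    (ContinuousLinearEquiv.unitsEquivAut ℝ (Units.mk0 _ h2)) (𝓕 (hc.toSchwartzMap hχ)), fun x => ?_⟩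
  change (𝓕 (hc.toSchwartzMap hχ) : SchwartzMap ℝ ℂ) (x * (2 * π)⁻¹) = _
  rw [SchwartzMap.fourier_coe, Real.fourier_real_eq_integral_exp_smul]
  refine integral_congr_ae (Eventually.of_forall fun k => ?_)
  change cexp _ * χ k = _
  rw [mul_comm]
  simp only
  congr 2
  have : (π : ℂ) ≠ 0 := by exact_mod_cast Real.pi_ne_zero
  push_cast
  field_simp

lemma spl_reflect {p q N : ℝ≥0∞} {h : ℂ → ℂ} (hs : Spl p q N h) : Spl q p N (fun z => h (I - z)) := by
  intro y hy
  obtain ⟨f, g, hf, hg, hfg, hfN, hgN⟩ := hs (1 - y) ⟨by linarith [hy.2], by linarith [hy.1]⟩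
  have hmp : MeasurePreserving (fun x : ℝ => -x) volume volume := Measure.measurePreserving_neg _
  refine ⟨fun x => g (-x), fun x => f (-x), hg.comp measurable_neg, hf.comp measurable_neg, ?_, ?_, ?_⟩
  · funext x
    have := congrFun hfg (-x)
    simp only [Pi.add_apply, bLine] at this ⊢
    rw [add_comm, this]
    congr 1
    push_cast
    ring
  · exact (eLpNorm_comp_measurePreserving hg.aestronglyMeasurable hmp).trans_le hgN
  · have := (eLpNorm_comp_measurePreserving hf.aestronglyMeasurable hmp).trans_le hfN
    rwa [sub_sub_cancel] at this

lemma TrP.reflect {h : ℂ → ℂ} {k : ℝ → ℂ} (ht : TrP (fun z => h (I - z)) k) (φ : SchwartzMap ℝ ℂ) :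
    Tendsto (fun y : ℝ => ∫ x : ℝ, h (x + y * I) * φ x) (𝓝[<] 1) (𝓝 (∫ x, k (-x) * φ x)) := by
  let ψ : SchwartzMap ℝ ℂ := SchwartzMap.compCLMOfContinuousLinearEquiv ℝ (ContinuousLinearEquiv.neg ℝ) φ
  have hψ : ∀ x, ψ x = φ (-x) := fun x => rfl
  have h1 : Tendsto (fun y : ℝ => 1 - y) (𝓝[<] 1) (𝓝[>] 0) := by
    refine tendsto_nhdsWithin_iff.2 ⟨?_, ?_⟩
    · have : Continuous (fun y : ℝ => 1 - y) := by fun_prop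
      have := (this.tendsto 1).mono_left (nhdsWithin_le_nhds (s := Iio 1))
      simpa using this
    · filter_upwards [self_mem_nhdsWithin] with y hy
      simpa using hy
  have := (ht.lim ψ).comp h1
  have e : ∫ x, k (-x) * φ x = ∫ x, k x * ψ x := by
    rw [← integral_neg_eq_self]
    simp [hψ]
  rw [e]
  refine this.congr fun y => ?_
  simp only [Function.comp_apply, hψ]
  rw [← integral_neg_eq_self]
  refine integral_congr_ae (Eventually.of_forall fun x => ?_)
  simp only [neg_neg]
  congr 2
  push_cast
  ring

lemma conj_schwartz (φ : SchwartzMap ℝ ℂ) : ∃ ψ : SchwartzMap ℝ ℂ, ∀ x, ψ x = (starRingEnd ℂ) (φ x) :=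
  ⟨SchwartzMap.postcompCLM (𝕜 := ℝ) (conjCLE : ℂ →L[ℝ] ℂ) φ, fun x => rfl⟩

/-- **Existence of boundary values in `H^{p,q}(S)`** (Lemma 2.7). -/
theorem existence_boundary_values (p q : ℝ≥0∞) (hp : 1 ≤ p) (hq : 1 ≤ q)
    (h : ℂ → ℂ) (hh : MemHardy p q h) :
    ∃ h0 h1 : ℝ → ℂ, IsTrace0 h h0 ∧ IsTrace1 h h1 ∧
      MemLp h0 p volume ∧ MemLp h1 q volume ∧
      (eLpNorm h0 p volume).toReal + (eLpNorm h1 q volume).toReal ≤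
        2 * (hardyNorm p q h).toReal ∧
      FourierRelExp h0 h1 := by
  obtain ⟨hd, hfin⟩ := hh
  obtain ⟨N, hN1, hN2⟩ := exists_between hfin
  have hs := spl_of_hardyNorm hN1
  have hd' : DifferentiableOn ℂ (fun z => h (I - z)) Strip := by
    refine hd.comp (by fun_prop) (fun z hz => ?_)
    have h1 := hz.1
    have h2 := hz.2
    constructor <;> simp <;> linarith
  obtain ⟨C, hC⟩ := hs.wb hp hq hN2.ne hd
  obtain ⟨C', hC'⟩ := (spl_reflect hs).wb hq hp hN2.ne hd'
  obtain ⟨h0, t0⟩ := trace_h hC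
  obtain ⟨k, t1⟩ := trace_h hC'
  have hmp : MeasurePreserving (fun x : ℝ => -x) volume volume := Measure.measurePreserving_neg _
  have hk1 : AEStronglyMeasurable k := t1.loc.aestronglyMeasurable
  have n0 : eLpNorm h0 p volume ≤ hardyNorm p q h := by
    refine le_of_forall_gt_imp_ge_of_dense fun M hM => ?_
    rcases eq_or_ne M ⊤ with rfl | hMt
    · exact le_top
    · exact trace_Lp (spl_of_hardyNorm hM) hp hq hMt t0
  have n1' : eLpNorm k q volume ≤ hardyNorm p q h := by
    refine le_of_forall_gt_imp_ge_of_dense fun M hM => ?_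
    rcases eq_or_ne M ⊤ with rfl | hMt
    · exact le_top
    · exact trace_Lp (spl_reflect (spl_of_hardyNorm hM)) hq hp hMt t1
  have n1 : eLpNorm (fun x => k (-x)) q volume ≤ hardyNorm p q h :=
    (eLpNorm_comp_measurePreserving hk1 hmp).trans_le n1'
  refine ⟨h0, fun x => k (-x), ?_, ?_, ?_, ?_, ?_, ?_⟩
  · intro φ
    obtain ⟨ψ, hψ⟩ := conj_schwartz φ
    simpa only [hψ] using t0.lim ψ
  · intro φ
    obtain ⟨ψ, hψ⟩ := conj_schwartz φ
    simpa only [hψ] using t1.reflect ψ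
  · exact ⟨t0.loc.aestronglyMeasurable, n0.trans_lt hfin⟩
  · exact ⟨hk1.comp_measurePreserving hmp, n1.trans_lt hfin⟩
  · have := ENNReal.toReal_mono hfin.ne n0
    have := ENNReal.toReal_mono hfin.ne n1
    linarith
  · intro φ hφ hc
    obtain ⟨B, hB0, hB⟩ := PhiF_bound φ hφ hc
    have hdiff := PhiF_diff φ hφ.continuous hc
    have hexp : ContDiff ℝ (⊤ : ℕ∞) (fun k : ℝ => (Real.exp (-k) : ℂ) * φ k) := by
      have h1 : ContDiff ℝ (⊤ : ℕ∞) (fun k : ℝ => Real.exp (-k)) := by fun_prop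
      exact (ofRealCLM.contDiff.comp h1).mul hφ
    obtain ⟨s0, hs0⟩ := fInt_schwartz _ hexp hc.mul_left
    obtain ⟨s1, hs1⟩ := fInt_schwartz _ hφ hc
    have e1 : ∀ x : ℝ, PhiF φ (x : ℂ) = s1 x := fun x => (hs1 x).symm
    have e0 : ∀ x : ℝ, PhiF φ (x + (-1 : ℝ) * I) = s0 x := by
      intro x
      rw [hs0]
      refine integral_congr_ae (Eventually.of_forall fun t => ?_)
      simp only
      have e3 : cexp (-(I * t * (x + (-1 : ℝ) * I))) = cexp ((-t : ℝ) : ℂ) * cexp (-(I * t * x)) := by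
        rw [← Complex.exp_add]
        congr 1
        push_cast
        linear_combination (t : ℂ) * I_sq
      rw [e3, ofReal_exp]
      ring
    have l0 := hC.limit0 (c := -1) (ψ := PhiF φ) hB0 hdiff.differentiableOn (fun z h1 h2 =>
      hB z (abs_le.2 ⟨h1, by linarith⟩))
    have l1 := hC'.limit0 (c := 0) (ψ := fun z => PhiF φ (-z)) hB0 (by fun_prop) (fun z h1 h2 => by
      have := hB (-z) (abs_le.2 ⟨by simp; linarith, by simp; linarith⟩)
      simpa using this)
    simp only [e0] at l0
    have u0 := tendsto_nhds_unique l0 (t0.lim s0)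
    let ψ : SchwartzMap ℝ ℂ := SchwartzMap.compCLMOfContinuousLinearEquiv ℝ (ContinuousLinearEquiv.neg ℝ) s1
    have hψ : ∀ x, ψ x = s1 (-x) := fun x => rfl
    have e2 : ∀ x : ℝ, PhiF φ (-(x + (0 : ℝ) * I)) = ψ x := by
      intro x
      rw [hψ, ← e1]; simp
    simp only [e2] at l1
    have u1 := tendsto_nhds_unique l1 (t1.lim ψ)
    simp only [← hs0, ← hs1]
    rw [← u0, ← integral_neg_eq_self]
    simp only [neg_neg, ← hψ]
    rw [← u1, ← integral_neg_eq_self]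
    refine integral_congr_ae (Eventually.of_forall fun x => ?_)
    simp only
    congr 2
    · push_cast; ring
    · push_cast; ring
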